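/- Let n ≥ 2 and let Φ be a translation invariant curvature measure on ℝⁿ such that Φ(K, ℝⁿ) = 0 for every convex body K, and such that Φ is SO(n) invariant, i.e., Φ(ρK, ρβ) = Φ(K, β) for every rotation ρ ∈ SO(n), every convex body K, and every Borel set β. Then Φ(K, β) = 0 for every convex body K and Borel set β. -/

import Mathlib

open MeasureTheory Metric Filter Topology
open scoped Pointwise

/-- ℝⁿ as Euclidean space. -/
abbrev Rn (n : ℕ) := EuclideanSpace ℝ (Fin n)

/-- A convex body: a nonempty compact convex subset of ℝⁿ. -/
def IsConvexBody {n : ℕ} (K : Set (Rn n)) : Prop :=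
  K.Nonempty ∧ IsCompact K ∧ Convex ℝ K

/-- Integral of a complex-valued function against a finite complex Borel measure,
defined via the Jordan decompositions of the real and imaginary parts. -/
noncomputable def cmIntegral {n : ℕ} (μ : ComplexMeasure (Rn n)) (f : Rn n → ℂ) : ℂ :=
  ((∫ x, f x ∂(ComplexMeasure.re μ).toJordanDecomposition.posPart)
    - (∫ x, f x ∂(ComplexMeasure.re μ).toJordanDecomposition.negPart))
  + Complex.I * ((∫ x, f x ∂(ComplexMeasure.im μ).toJordanDecomposition.posPart)
    - (∫ x, f x ∂(ComplexMeasure.im μ).toJordanDecomposition.negPart))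

/-- The total variation measure of a finite complex Borel measure (a set is null for this
measure iff it is null for the classical total variation measure). -/
noncomputable def cmVariation {n : ℕ} (μ : ComplexMeasure (Rn n)) : Measure (Rn n) :=
  (ComplexMeasure.re μ).totalVariation + (ComplexMeasure.im μ).totalVariation

/-- A translation invariant curvature measure on ℝⁿ: a map assigning to each convex body
a finite complex Borel measure, which is local, translation invariant, and weakly continuous
with respect to Hausdorff convergence of convex bodies. -/
structure CurvatureMeasure (n : ℕ) where
  /-- the finite complex Borel measure associated to a convex body -/
  meas : Set (Rn n) → ComplexMeasure (Rn n)
  locality : ∀ K L U : Set (Rn n), IsConvexBody K → IsConvexBody L → IsOpen U →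
    K ∩ U = L ∩ U → ∀ β : Set (Rn n), MeasurableSet β → β ⊆ U → meas K β = meas L β
  translation_invariant : ∀ K : Set (Rn n), IsConvexBody K → ∀ x : Rn n,
    ∀ β : Set (Rn n), MeasurableSet β →
      meas ((fun y => y + x) '' K) ((fun y => y + x) '' β) = meas K β
  continuity : ∀ (Ki : ℕ → Set (Rn n)) (K : Set (Rn n)), (∀ i, IsConvexBody (Ki i)) →
    IsConvexBody K → Tendsto (fun i => hausdorffDist (Ki i) K) atTop (𝓝 0) →
    ∀ f : BoundedContinuousFunction (Rn n) ℂ,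
      Tendsto (fun i => cmIntegral (meas (Ki i)) f) atTop (𝓝 (cmIntegral (meas K) f))

/-- A curvature measure is homogeneous of degree `k`. -/
def CurvatureMeasure.Homogeneous {n : ℕ} (Φ : CurvatureMeasure n) (k : ℕ) : Prop :=
  ∀ t : ℝ, 0 < t → ∀ K : Set (Rn n), IsConvexBody K → ∀ β : Set (Rn n), MeasurableSet β →
    Φ.meas (t • K) (t • β) = (t : ℂ) ^ k * Φ.meas K β

/-- A curvature measure is SO(n) invariant: invariant under every orientation preserving
linear isometry (rotation) of ℝⁿ. -/
def CurvatureMeasure.SOInvariant {n : ℕ} (Φ : CurvatureMeasure n) : Prop :=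
  ∀ ρ : Rn n ≃ₗᵢ[ℝ] Rn n, 0 < LinearMap.det (ρ.toLinearEquiv : Rn n →ₗ[ℝ] Rn n) →
    ∀ K : Set (Rn n), IsConvexBody K → ∀ β : Set (Rn n), MeasurableSet β →
      Φ.meas (ρ '' K) (ρ '' β) = Φ.meas K β

namespace CMZ

set_option linter.unusedSectionVars false

variable {V : Type} [NormedAddCommGroup V] [InnerProductSpace ℝ V] [FiniteDimensional ℝ V]
  [MeasurableSpace V] [BorelSpace V]

/-- convex body in an abstract space -/
def Body {V : Type} [NormedAddCommGroup V] [InnerProductSpace ℝ V] (K : Set V) : Prop :=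
  K.Nonempty ∧ IsCompact K ∧ Convex ℝ K

/-- bounded continuous real function -/
def BC {V : Type} [TopologicalSpace V] (f : V → ℝ) : Prop :=
  Continuous f ∧ ∃ C, ∀ x, |f x| ≤ C

theorem BC.cont {V : Type} [TopologicalSpace V] {f : V → ℝ} (h : BC f) : Continuous f := h.1

theorem BC.const {V : Type} [TopologicalSpace V] (c : ℝ) : BC (fun _ : V => c) :=
  ⟨continuous_const, |c|, fun _ => le_rfl⟩

theorem BC.add {V : Type} [TopologicalSpace V] {f g : V → ℝ} (hf : BC f) (hg : BC g) :
    BC (fun x => f x + g x) := by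
  obtain ⟨hf, A, hA⟩ := hf
  obtain ⟨hg, B, hB⟩ := hg
  exact ⟨hf.add hg, A + B, fun x => (abs_add_le _ _).trans (add_le_add (hA x) (hB x))⟩

theorem BC.neg {V : Type} [TopologicalSpace V] {f : V → ℝ} (hf : BC f) :
    BC (fun x => - f x) := by
  obtain ⟨hf, A, hA⟩ := hf
  exact ⟨hf.neg, A, fun x => by rw [abs_neg]; exact hA x⟩

theorem BC.sub {V : Type} [TopologicalSpace V] {f g : V → ℝ} (hf : BC f) (hg : BC g) :
    BC (fun x => f x - g x) := by
  simpa [sub_eq_add_neg] using hf.add hg.neg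

theorem BC.mul {V : Type} [TopologicalSpace V] {f g : V → ℝ} (hf : BC f) (hg : BC g) :
    BC (fun x => f x * g x) := by
  obtain ⟨hf, A, hA⟩ := hf
  obtain ⟨hg, B, hB⟩ := hg
  refine ⟨hf.mul hg, A * B, fun x => ?_⟩
  rw [abs_mul]
  exact mul_le_mul (hA x) (hB x) (abs_nonneg _) ((abs_nonneg _).trans (hA x))

theorem BC.comp {V W : Type} [TopologicalSpace V] [TopologicalSpace W] {f : V → ℝ} (hf : BC f)
    {g : W → V} (hg : Continuous g) : BC (fun x => f (g x)) := by
  obtain ⟨hf, A, hA⟩ := hf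
  exact ⟨hf.comp hg, A, fun x => hA _⟩

theorem BC.prod {V ι : Type} [TopologicalSpace V] (s : Finset ι) {f : ι → V → ℝ}
    (hf : ∀ i, BC (f i)) : BC (fun x => ∏ i ∈ s, f i x) := by
  classical
  induction s using Finset.induction_on with
  | empty => simpa using BC.const 1
  | insert a s ha ih => simpa [Finset.prod_insert ha] using (hf a).mul ih

theorem BC.integrable {f : V → ℝ} (hf : BC f) (μ : Measure V) [IsFiniteMeasure μ] :
    Integrable f μ := by
  obtain ⟨hf, A, hA⟩ := hf
  exact Integrable.of_bound hf.aestronglyMeasurable A (ae_of_all _ hA)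

/-- integral against a difference of measures -/
noncomputable def II (μ ν : Measure V) (f : V → ℝ) : ℝ := (∫ x, f x ∂μ) - ∫ x, f x ∂ν

theorem II_add (μ ν : Measure V) [IsFiniteMeasure μ] [IsFiniteMeasure ν] {f g : V → ℝ}
    (hf : BC f) (hg : BC g) : II μ ν (fun x => f x + g x) = II μ ν f + II μ ν g := by
  unfold II
  rw [integral_add (hf.integrable μ) (hg.integrable μ),
    integral_add (hf.integrable ν) (hg.integrable ν)]
  ring

theorem II_sub (μ ν : Measure V) [IsFiniteMeasure μ] [IsFiniteMeasure ν] {f g : V → ℝ}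
    (hf : BC f) (hg : BC g) : II μ ν (fun x => f x - g x) = II μ ν f - II μ ν g := by
  unfold II
  rw [integral_sub (hf.integrable μ) (hg.integrable μ),
    integral_sub (hf.integrable ν) (hg.integrable ν)]
  ring

theorem II_mul (μ ν : Measure V) (c : ℝ) (f : V → ℝ) :
    II μ ν (fun x => c * f x) = c * II μ ν f := by
  unfold II
  rw [integral_const_mul, integral_const_mul]
  ring

theorem II_bound (μ ν : Measure V) [IsFiniteMeasure μ] [IsFiniteMeasure ν] {f : V → ℝ} {C : ℝ}
    (hC : ∀ x, |f x| ≤ C) : |II μ ν f| ≤ (μ.real Set.univ + ν.real Set.univ) * C := by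
  unfold II
  have h1 := norm_integral_le_of_norm_le_const (μ := μ) (f := f) (ae_of_all _ hC)
  have h2 := norm_integral_le_of_norm_le_const (μ := ν) (f := f) (ae_of_all _ hC)
  rw [Real.norm_eq_abs] at h1 h2
  have := abs_sub (∫ x, f x ∂μ) (∫ x, f x ∂ν)
  linarith

/-- if test functions supported in an open set do not distinguish two finite measures, their
restrictions to the open set agree -/
theorem restrict_eq_of_II (μ ν : Measure V) [IsFiniteMeasure μ] [IsFiniteMeasure ν]
    {U : Set V} (hU : IsOpen U)
    (h : ∀ f, BC f → (∀ x ∉ U, f x = 0) → II μ ν f = 0) : μ.restrict U = ν.restrict U := by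
  have key : ∀ O : Set V, IsOpen O → O ⊆ U → μ O = ν O := by
    intro O hO hOU
    rw [← measureReal_eq_measureReal_iff]
    by_cases hne : (Oᶜ).Nonempty
    · have hbc : ∀ k : ℕ, BC (fun x => min 1 ((k:ℝ) * infDist x Oᶜ)) := by
        intro k
        refine ⟨continuous_const.min (continuous_const.mul (continuous_infDist_pt _)), 1, fun x => ?_⟩
        rw [abs_of_nonneg]
        · exact min_le_left _ _
        · exact le_min zero_le_one (mul_nonneg (Nat.cast_nonneg _) infDist_nonneg)
      have hz : ∀ x ∉ O, infDist x Oᶜ = 0 := fun x hx => infDist_zero_of_mem (by simpa using hx)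
      have hlim : ∀ ρ : Measure V, IsFiniteMeasure ρ →
          Tendsto (fun k : ℕ => ∫ x, min 1 ((k:ℝ) * infDist x Oᶜ) ∂ρ) atTop
          (𝓝 (∫ x, O.indicator 1 x ∂ρ)) := by
        intro ρ _
        refine tendsto_integral_of_dominated_convergence (fun _ => (1:ℝ)) ?_ (integrable_const 1) ?_ ?_
        · intro k
          exact (hbc k).1.aestronglyMeasurable
        · intro k
          refine ae_of_all _ fun x => ?_
          rw [Real.norm_eq_abs, abs_of_nonneg]
          · exact min_le_left _ _
          · exact le_min zero_le_one (mul_nonneg (Nat.cast_nonneg _) infDist_nonneg)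
        · refine ae_of_all _ fun x => ?_
          by_cases hx : x ∈ O
          · rw [Set.indicator_of_mem hx]
            have hpos : 0 < infDist x Oᶜ :=
              (hO.isClosed_compl.notMem_iff_infDist_pos hne).1 (by simpa using hx)
            refine tendsto_const_nhds.congr' ?_
            obtain ⟨k0, hk0⟩ := exists_nat_gt (1 / infDist x Oᶜ)
            filter_upwards [eventually_ge_atTop k0] with k hk
            have : (k0:ℝ) ≤ k := by exact_mod_cast hk
            rw [min_eq_left]
            · rfl
            rw [div_lt_iff₀ hpos] at hk0
            nlinarith
          · rw [Set.indicator_of_notMem hx]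
            simp [hz x hx]
      have e1 := (hlim μ inferInstance).sub (hlim ν inferInstance)
      have e2 : ∀ k : ℕ, (∫ x, min 1 ((k:ℝ) * infDist x Oᶜ) ∂μ) -
          (∫ x, min 1 ((k:ℝ) * infDist x Oᶜ) ∂ν) = 0 := by
        intro k
        exact h _ (hbc k) (fun x hx => by simp [hz x (fun h' => hx (hOU h'))])
      simp only [e2] at e1
      have e3 := tendsto_nhds_unique e1 tendsto_const_nhds
      rw [integral_indicator_one hO.measurableSet, integral_indicator_one hO.measurableSet] at e3
      linarith
    · have hO' : O = Set.univ := by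
        rw [Set.not_nonempty_iff_eq_empty] at hne
        simpa using hne
      have hU' : U = Set.univ := Set.eq_univ_of_univ_subset (hO' ▸ hOU)
      have := h (fun _ => 1) (BC.const 1) (by simp [hU'])
      unfold II at this
      simp at this
      rw [hO']
      linarith
  refine ext_of_generate_finite {O : Set V | IsOpen O}
    (BorelSpace.measurable_eq (α := V)) isPiSystem_isOpen ?_ ?_
  · intro O hO
    rw [Measure.restrict_apply hO.measurableSet, Measure.restrict_apply hO.measurableSet]
    exact key _ (hO.inter hU) Set.inter_subset_right
  · simp [key U hU le_rfl]

/-- local to global -/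
theorem II_local (μ ν : Measure V) [IsFiniteMeasure μ] [IsFiniteMeasure ν] {f : V → ℝ}
    (hfc : BC f)
    (h : ∀ x, f x ≠ 0 → ∃ U, IsOpen U ∧ x ∈ U ∧ ∀ g, BC g → (∀ y ∉ U, g y = 0) → II μ ν g = 0) :
    II μ ν f = 0 := by
  classical
  let C : Set (Set V) := {U | IsOpen U ∧ ∀ g, BC g → (∀ y ∉ U, g y = 0) → II μ ν g = 0}
  obtain ⟨T, hTc, hTC, hTU⟩ := TopologicalSpace.isOpen_sUnion_countable C (fun U hU => hU.1)
  have e : μ.restrict (⋃₀ T) = ν.restrict (⋃₀ T) := by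
    rw [Measure.restrict_sUnion_congr hTc]
    intro U hU
    exact restrict_eq_of_II μ ν (hTC hU).1 (hTC hU).2
  have hz : ∀ x ∉ ⋃₀ T, f x = 0 := by
    intro x hx
    by_contra hne
    obtain ⟨U, hU, hxU, hg⟩ := h x hne
    rw [hTU] at hx
    exact hx ⟨U, ⟨hU, hg⟩, hxU⟩
  unfold II
  rw [← setIntegral_eq_integral_of_forall_compl_eq_zero (μ := μ) (s := ⋃₀ T) hz,
    ← setIntegral_eq_integral_of_forall_compl_eq_zero (μ := ν) (s := ⋃₀ T) hz, e, sub_self]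

theorem eq_of_II (μ ν : Measure V) [IsFiniteMeasure μ] [IsFiniteMeasure ν]
    (h : ∀ f, BC f → II μ ν f = 0) : μ = ν := by
  have := restrict_eq_of_II μ ν isOpen_univ (fun f hf _ => h f hf)
  simpa using this

/-- abstract (real) translation invariant curvature measures -/
structure CM (V : Type) [NormedAddCommGroup V] [InnerProductSpace ℝ V] [MeasurableSpace V] where
  P : Set V → Measure V
  N : Set V → Measure V
  finP : ∀ K, IsFiniteMeasure (P K)
  finN : ∀ K, IsFiniteMeasure (N K)
  loc : ∀ K L U : Set V, Body K → Body L → IsOpen U → K ∩ U = L ∩ U → ∀ f, BC f →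
    (∀ x ∉ U, f x = 0) → II (P K) (N K) f = II (P L) (N L) f
  trans : ∀ K, Body K → ∀ x : V, ∀ f, BC f →
    II (P ((fun y => y + x) '' K)) (N ((fun y => y + x) '' K)) f
      = II (P K) (N K) (fun y => f (y + x))
  cont : ∀ (Ki : ℕ → Set V) (K : Set V), (∀ i, Body (Ki i)) → Body K →
    Tendsto (fun i => hausdorffDist (Ki i) K) atTop (𝓝 0) → ∀ f, BC f →
    Tendsto (fun i => II (P (Ki i)) (N (Ki i)) f) atTop (𝓝 (II (P K) (N K) f))

attribute [instance] CM.finP CM.finN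

noncomputable def CM.I (c : CM V) (K : Set V) (f : V → ℝ) : ℝ := II (c.P K) (c.N K) f

theorem CM.I_local (c : CM V) {K : Set V} {f : V → ℝ} (hfc : BC f)
    (h : ∀ x, f x ≠ 0 → ∃ U, IsOpen U ∧ x ∈ U ∧ ∀ g, BC g → (∀ y ∉ U, g y = 0) → c.I K g = 0) :
    c.I K f = 0 := II_local _ _ hfc h

theorem Body.translate {K : Set V} (hK : Body K) (x : V) : Body ((fun y => y + x) '' K) := by
  refine ⟨hK.1.image _, hK.2.1.image (by fun_prop), ?_⟩
  have := hK.2.2.translate x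
  simpa [add_comm] using this

theorem mem_translate {K : Set V} {x y : V} : y ∈ (fun y => y + x) '' K ↔ y - x ∈ K := by
  constructor
  · rintro ⟨z, hz, rfl⟩
    simpa using hz
  · intro h
    exact ⟨y - x, h, by simp⟩

/-- support in the body -/
theorem CM.I_supp [Nontrivial V] (c : CM V) {K : Set V} (hK : Body K) {f : V → ℝ} (hf : BC f)
    (hz : ∀ x ∈ K, f x = 0) : c.I K f = 0 := by
  refine c.I_local hf fun x hx => ?_
  have hxK : x ∉ K := fun h => hx (hz x h)
  obtain ⟨r, hr, hrK⟩ := Metric.isOpen_iff.1 hK.2.1.isClosed.isOpen_compl x hxK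
  refine ⟨ball x r, isOpen_ball, mem_ball_self hr, fun g hg hgz => ?_⟩
  obtain ⟨e, he⟩ := exists_ne (0 : V)
  obtain ⟨R, hR⟩ := hK.2.1.isBounded.exists_norm_le
  have hepos : 0 < ‖e‖ := norm_pos_iff.2 he
  have tend : Tendsto (fun k : ℕ => (k:ℝ) * ‖e‖) atTop atTop :=
    tendsto_natCast_atTop_atTop.atTop_mul_const hepos
  have h1 : ∀ᶠ k : ℕ in atTop, c.I K g = c.I K (fun y => g (y + (k:ℝ) • e)) := by
    filter_upwards [tend.eventually_gt_atTop (‖x‖ + r + R)] with k hk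
    unfold CM.I
    rw [← c.trans K hK ((k:ℝ) • e) g hg]
    refine c.loc _ _ (ball x r) hK (hK.translate _) isOpen_ball ?_ g hg hgz
    ext y
    constructor
    · rintro ⟨h1, h2⟩
      exact absurd h1 (hrK h2)
    · rintro ⟨h1, h2⟩
      exfalso
      rw [mem_translate] at h1
      have a1 := hR _ h1
      have a2 : ‖(k:ℝ) • e‖ = k * ‖e‖ := by rw [norm_smul]; simp
      rw [mem_ball, dist_eq_norm] at h2
      have a3 : ‖(k:ℝ) • e‖ ≤ ‖y - (k:ℝ)•e‖ + ‖y - x‖ + ‖x‖ := by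
        have : (k:ℝ) • e = -(y - (k:ℝ)•e) + (y - x) + x := by abel
        calc ‖(k:ℝ) • e‖ = ‖-(y - (k:ℝ)•e) + (y - x) + x‖ := by rw [← this]
          _ ≤ ‖-(y - (k:ℝ)•e)‖ + ‖(y - x)‖ + ‖x‖ := norm_add₃_le
          _ = _ := by rw [norm_neg]
      linarith
  have h2 : Tendsto (fun k : ℕ => c.I K (fun y => g (y + (k:ℝ) • e))) atTop (𝓝 0) := by
    have : ∀ ρ : Measure V, IsFiniteMeasure ρ →
        Tendsto (fun k : ℕ => ∫ y, g (y + (k:ℝ) • e) ∂ρ) atTop (𝓝 (∫ y, 0 ∂ρ)) := by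
      intro ρ _
      obtain ⟨C, hC⟩ := hg.2
      refine tendsto_integral_of_dominated_convergence (fun _ => C) ?_ (integrable_const C) ?_ ?_
      · intro k
        exact (hg.1.comp (by fun_prop : Continuous fun y => y + (k:ℝ) • e)).aestronglyMeasurable
      · intro k
        exact ae_of_all _ fun y => hC _
      · refine ae_of_all _ fun y => ?_
        refine tendsto_const_nhds.congr' ?_
        filter_upwards [tend.eventually_gt_atTop (‖x‖ + r + ‖y‖)] with k hk
        symm
        apply hgz
        intro hy
        rw [mem_ball, dist_eq_norm] at hy
        have a2 : ‖(k:ℝ) • e‖ = k * ‖e‖ := by rw [norm_smul]; simp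
        have a3 : ‖(k:ℝ) • e‖ ≤ ‖y‖ + ‖y + (k:ℝ) • e - x‖ + ‖x‖ := by
          have : (k:ℝ) • e = -y + (y + (k:ℝ) • e - x) + x := by abel
          calc ‖(k:ℝ) • e‖ = ‖-y + (y + (k:ℝ) • e - x) + x‖ := by rw [← this]
            _ ≤ ‖-y‖ + ‖(y + (k:ℝ) • e - x)‖ + ‖x‖ := norm_add₃_le
            _ = _ := by rw [norm_neg]
        linarith
    simpa [CM.I, II] using (this (c.P K) inferInstance).sub (this (c.N K) inferInstance)
  have h3 : Tendsto (fun k : ℕ => c.I K g) atTop (𝓝 0) :=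
    h2.congr' (h1.mono fun k hk => hk.symm)
  exact tendsto_nhds_unique tendsto_const_nhds h3

end CMZ

namespace CMZ

set_option linter.unusedSectionVars false

variable {V : Type} [NormedAddCommGroup V] [InnerProductSpace ℝ V] [FiniteDimensional ℝ V]
  [MeasurableSpace V] [BorelSpace V]

theorem integrable_of_supp {g : V → ℝ} (hg : BC g) {r : ℝ} (hz : ∀ x ∉ ball (0:V) r, g x = 0) :
    Integrable g (volume : Measure V) := by
  refine hg.1.integrable_of_hasCompactSupport ?_
  refine HasCompactSupport.of_support_subset_isCompact (isCompact_closedBall (0:V) r) ?_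
  intro x hx
  by_contra h
  exact hx (hz x fun h' => h (ball_subset_closedBall h'))

theorem body_ball (x : V) {r : ℝ} (hr : 0 ≤ r) : Body (closedBall x r) :=
  ⟨nonempty_closedBall.2 hr, isCompact_closedBall _ _, convex_closedBall _ _⟩

theorem CM.conv_half (c : CM V) {D : Set V} (hD : Body D) {r : ℝ} (hr : ball (0:V) (2*r) ⊆ D)
    {f g : V → ℝ} (hf : BC f) (hg : BC g) (hfz : ∀ x ∉ ball (0:V) r, f x = 0)
    (hgz : ∀ x ∉ ball (0:V) r, g x = 0) :
    c.I D (fun x => ∫ t, f (x - t) * g t) = c.I D f * ∫ t, g t := by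
  have hgi := integrable_of_supp hg hgz
  have hint : ∀ ρ : Measure V, IsFiniteMeasure ρ →
      Integrable (Function.uncurry fun (x t : V) => f (x - t) * g t) (ρ.prod volume) := by
    intro ρ _
    obtain ⟨C, hC⟩ := hf.2
    have h1 : Integrable (fun p : V × V => C * g p.2) (ρ.prod volume) :=
      (hgi.comp_snd ρ).const_mul C
    refine h1.mono ?_ ?_
    · have := hf.1
      have := hg.1
      exact Continuous.aestronglyMeasurable (by unfold Function.uncurry; fun_prop)
    · refine ae_of_all _ fun p => ?_
      simp only [Function.uncurry, norm_mul, Real.norm_eq_abs]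
      refine mul_le_mul_of_nonneg_right ((hC _).trans (le_abs_self C)) (abs_nonneg _)
  have hsw : ∀ ρ : Measure V, IsFiniteMeasure ρ →
      ∫ x, (∫ t, f (x - t) * g t) ∂ρ = ∫ t, (∫ x, f (x - t) ∂ρ) * g t := by
    intro ρ _
    rw [integral_integral_swap (hint ρ inferInstance)]
    simp only [integral_mul_const]
  have hint2 : ∀ ρ : Measure V, IsFiniteMeasure ρ →
      Integrable (fun t => (∫ x, f (x - t) ∂ρ) * g t) := by
    intro ρ _
    have := (hint ρ inferInstance).integral_prod_right
    simpa only [Function.uncurry, integral_mul_const] using this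
  unfold CM.I
  conv_lhs => unfold II
  rw [hsw _ inferInstance, hsw _ inferInstance, ← integral_sub (hint2 _ inferInstance) (hint2 _ inferInstance),
    ← integral_const_mul]
  congr 1
  ext t
  rw [← sub_mul]
  by_cases ht : t ∈ ball (0:V) r
  · congr 1
    have e1 : (fun x => f (x - t)) = fun x => f (x + -t) := by simp only [sub_eq_add_neg]
    change II _ _ (fun x => f (x - t)) = _
    rw [e1, ← c.trans D hD (-t) f hf]
    refine c.loc _ _ (ball 0 r) (hD.translate _) hD isOpen_ball ?_ f hf hfz
    ext y
    have hy : y ∈ ball (0:V) r → y ∈ D ∧ y - -t ∈ D := by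
      intro hy
      rw [mem_ball_zero_iff] at hy ht
      refine ⟨hr ?_, hr ?_⟩
      · rw [mem_ball_zero_iff]; linarith [norm_nonneg y]
      · rw [mem_ball_zero_iff, sub_neg_eq_add]; linarith [norm_add_le y t]
    simp only [Set.mem_inter_iff, mem_translate]
    constructor
    · rintro ⟨h1, h2⟩; exact ⟨(hy h2).1, h2⟩
    · rintro ⟨h1, h2⟩; exact ⟨(hy h2).2, h2⟩
  · rw [hgz t ht]; simp

theorem CM.conv_symm (c : CM V) {D : Set V} (hD : Body D) {r : ℝ} (hr : ball (0:V) (2*r) ⊆ D)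
    {f g : V → ℝ} (hf : BC f) (hg : BC g) (hfz : ∀ x ∉ ball (0:V) r, f x = 0)
    (hgz : ∀ x ∉ ball (0:V) r, g x = 0) :
    c.I D f * ∫ t, g t = c.I D g * ∫ t, f t := by
  rw [← c.conv_half hD hr hf hg hfz hgz, ← c.conv_half hD hr hg hf hgz hfz]
  congr 1
  ext x
  rw [← integral_sub_left_eq_self _ volume x]
  congr 1
  ext t
  simp [mul_comm]

/-- vanishing in the interior -/
def CM.IntZ (c : CM V) : Prop :=
  ∀ K, Body K → ∀ f, BC f → (∀ x ∉ interior K, f x = 0) → c.I K f = 0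

theorem CM.intZ_of (c : CM V) {g : V → ℝ} (hg : BC g) {r : ℝ} (hgz : ∀ x ∉ ball (0:V) r, g x = 0)
    (hgi : ∫ t, g t ≠ 0) {D : Set V} (hD : Body D) (hDr : ∀ x, g x ≠ 0 → x ∈ D)
    (hDg : c.I D g = 0) : c.IntZ := by
  intro K hK f hf hfz
  refine c.I_local hf fun x hx => ?_
  have hxK : x ∈ interior K := by
    by_contra h
    exact hx (hfz x h)
  obtain ⟨s, hs, hsK⟩ := Metric.isOpen_iff.1 isOpen_interior x hxK
  refine ⟨ball x s, isOpen_ball, mem_ball_self hs, fun h hh hhz => ?_⟩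
  -- move to the origin
  set R := max r s with hR
  have hB : Body (closedBall (0:V) (2*R)) := body_ball _ (by
    have : s ≤ R := le_max_right _ _
    linarith)
  have e0 : K = (fun y => y + x) '' ((fun y => y + -x) '' K) := by
    ext y; simp [mem_translate]
  have h'z : ∀ y ∉ ball (0:V) s, h (y + x) = 0 := by
    intro y hy
    refine hhz _ fun h' => hy ?_
    simpa [mem_ball, dist_eq_norm] using h'
  have h'bc : BC (fun y => h (y + x)) := hh.comp (by fun_prop)
  have e1 : c.I K h = c.I (closedBall (0:V) (2*R)) (fun y => h (y + x)) := by
    unfold CM.I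
    rw [e0, c.trans _ (hK.translate _) x h hh]
    refine c.loc _ _ (ball 0 s) (hK.translate _) hB isOpen_ball ?_ _ h'bc h'z
    ext y
    simp only [Set.mem_inter_iff, mem_translate]
    refine and_congr_left fun hy => iff_of_true ?_ ?_
    · apply interior_subset
      apply hsK
      simpa [mem_ball, dist_eq_norm] using hy
    · rw [mem_closedBall_zero_iff]
      rw [mem_ball_zero_iff] at hy
      have : s ≤ R := le_max_right _ _
      linarith [norm_nonneg y]
  have e2 : c.I (closedBall (0:V) (2*R)) g = 0 := by
    rw [← hDg]
    refine c.loc _ _ {x | g x ≠ 0} hB hD (isOpen_ne_fun hg.1 continuous_const) ?_ g hg (by simp)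
    ext y
    simp only [Set.mem_inter_iff]
    refine and_congr_left fun hy => iff_of_true ?_ (hDr y hy)
    have : y ∈ ball (0:V) r := by
      by_contra h; exact hy (hgz y h)
    rw [mem_ball_zero_iff] at this
    rw [mem_closedBall_zero_iff]
    have : r ≤ R := le_max_left _ _
    linarith [norm_nonneg y]
  have e3 := c.conv_symm hB (r := R) ball_subset_closedBall h'bc hg
    (fun y hy => h'z y fun h' => hy (ball_subset_ball (le_max_right _ _) h'))
    (fun y hy => hgz y fun h' => hy (ball_subset_ball (le_max_left _ _) h'))
  rw [e2, zero_mul, ← e1] at e3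
  exact (mul_eq_zero.1 e3).resolve_right hgi

/-- reflection -/
noncomputable def rf {V : Type} [NormedAddCommGroup V] [InnerProductSpace ℝ V] (v x : V) : V :=
  x - (2 * inner ℝ v x / inner ℝ v v) • v

theorem rf_cont (v : V) : Continuous (rf v) := by
  unfold rf
  fun_prop

theorem rf_sub (v x y : V) : rf v (x - y) = rf v x - rf v y := by
  simp only [rf, inner_sub_right]
  rw [mul_sub, sub_div, sub_smul]; abel

theorem rf_add (v x y : V) : rf v (x + y) = rf v x + rf v y := by
  simp only [rf, inner_add_right]
  rw [mul_add, add_div, add_smul]; abel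

theorem rf_smul (v : V) (t : ℝ) (x : V) : rf v (t • x) = t • rf v x := by
  simp only [rf, inner_smul_right, smul_sub, smul_smul]
  congr 2
  ring

theorem inner_rf_rf {v : V} (hv : v ≠ 0) (x y : V) : inner ℝ (rf v x) (rf v y) = inner ℝ x y := by
  have h : inner ℝ v v ≠ 0 := by simpa using hv
  simp only [rf, inner_sub_right, inner_sub_left, inner_smul_left, inner_smul_right,
    real_inner_comm v x]
  simp
  field_simp
  ring

theorem rf_rf {v : V} (hv : v ≠ 0) (x : V) : rf v (rf v x) = x := by
  have h : inner ℝ v v ≠ 0 := by simpa using hv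
  simp only [rf, inner_sub_right, inner_smul_right]
  rw [div_mul_cancel₀ _ h, sub_sub, ← add_smul]
  have : 2 * inner ℝ v x / inner ℝ v v + 2 * (inner ℝ v x - 2 * inner ℝ v x) / inner ℝ v v = 0 := by
    field_simp; ring
  rw [this]; simp

theorem norm_rf {v : V} (hv : v ≠ 0) (x : V) : ‖rf v x‖ = ‖x‖ := by
  rw [norm_eq_sqrt_real_inner, norm_eq_sqrt_real_inner, inner_rf_rf hv]

theorem inner_rf_left {v : V} (hv : v ≠ 0) (x y : V) : inner ℝ (rf v x) y = inner ℝ x (rf v y) := by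
  rw [← inner_rf_rf hv, rf_rf hv]

theorem rf_of_inner {v x : V} (h : inner ℝ v x = 0) : rf v x = x := by simp [rf, h]

theorem rf_swap {x y : V} (h : ‖x‖ = ‖y‖) (hne : x ≠ y) : rf (x - y) x = y := by
  have h0 : inner ℝ (x-y) (x-y) ≠ 0 := by simpa [sub_eq_zero] using hne
  have h2 : inner ℝ x x = inner ℝ y y := by
    rw [real_inner_self_eq_norm_sq, real_inner_self_eq_norm_sq, h]
  have h1 : 2 * inner ℝ (x-y) x / inner ℝ (x-y) (x-y) = 1 := by
    rw [div_eq_one_iff_eq h0]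
    simp only [inner_sub_left, inner_sub_right, real_inner_comm x y]
    linarith
  unfold rf
  rw [h1]; simp

theorem mem_rf_image {v : V} (hv : v ≠ 0) {K : Set V} {y : V} : y ∈ rf v '' K ↔ rf v y ∈ K := by
  constructor
  · rintro ⟨z, hz, rfl⟩
    rwa [rf_rf hv]
  · intro h
    exact ⟨_, h, rf_rf hv y⟩

theorem Body.rf {K : Set V} (hK : Body K) (v : V) : Body (rf v '' K) := by
  refine ⟨hK.1.image _, hK.2.1.image (rf_cont v), ?_⟩
  rintro _ ⟨x, hx, rfl⟩ _ ⟨y, hy, rfl⟩ a b ha hb hab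
  exact ⟨a • x + b • y, hK.2.2 hx hy ha hb hab, by rw [rf_add, rf_smul, rf_smul]⟩

/-- (anti-)invariance under reflections -/
def CM.Inv (c : CM V) (σ : ℝ) : Prop :=
  ∀ v : V, v ≠ 0 → ∀ K, Body K → ∀ f, BC f → c.I (rf v '' K) f = σ * c.I K (fun x => f (rf v x))

theorem CM.intZ_anti [Nontrivial V] (c : CM V) (hc : c.Inv (-1)) : c.IntZ := by
  obtain ⟨e, he⟩ := exists_ne (0 : V)
  have hcont : Continuous fun x : V => max 0 (1 - ‖x‖) := by fun_prop
  have hz : ∀ x ∉ ball (0:V) 1, max 0 (1 - ‖x‖) = 0 := by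
    intro x hx
    rw [mem_ball_zero_iff, not_lt] at hx
    exact max_eq_left (by linarith)
  have hbc : BC fun x : V => max 0 (1 - ‖x‖) := by
    refine ⟨hcont, 1, fun x => ?_⟩
    rw [abs_of_nonneg (le_max_left _ _)]
    exact max_le zero_le_one (by linarith [norm_nonneg x])
  refine c.intZ_of (g := fun x => max 0 (1 - ‖x‖)) (r := 1) hbc hz ?_ (body_ball 0 zero_le_one) ?_ ?_
  · refine (hcont.integral_pos_of_hasCompactSupport_nonneg_nonzero (x := 0) ?_ ?_ ?_).ne'
    · refine HasCompactSupport.of_support_subset_isCompact (isCompact_closedBall (0:V) 1) ?_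
      intro x hx
      by_contra h
      exact hx (hz x fun h' => h (ball_subset_closedBall h'))
    · intro x; exact le_max_left _ _
    · simp
  · intro x hx
    by_contra h
    exact hx (hz x fun h' => h (ball_subset_closedBall h'))
  · have := hc e he _ (body_ball 0 zero_le_one) _ hbc
    have e2 : rf e '' (closedBall (0:V) 1) = closedBall 0 1 := by
      ext y
      rw [mem_rf_image he, mem_closedBall_zero_iff, mem_closedBall_zero_iff, norm_rf he]
    rw [e2] at this
    simp only [norm_rf he] at this
    linarith

end CMZ

namespace CMZ

set_option linter.unusedSectionVars false

variable {V : Type} [NormedAddCommGroup V] [InnerProductSpace ℝ V] [FiniteDimensional ℝ V]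
  [MeasurableSpace V] [BorelSpace V]

noncomputable def rp (t : ℝ) : ℝ := max 0 (min t 1)

theorem rp_cont : Continuous rp := by unfold rp; fun_prop

theorem rp_of_le {t : ℝ} (h : t ≤ 0) : rp t = 0 := by
  unfold rp; rw [min_eq_left (by linarith)]; exact max_eq_left h

theorem rp_of_ge {t : ℝ} (h : 1 ≤ t) : rp t = 1 := by
  unfold rp; rw [min_eq_right h]; exact max_eq_right zero_le_one

theorem rp_nonneg (t : ℝ) : 0 ≤ rp t := le_max_left _ _

theorem rp_le (t : ℝ) : rp t ≤ 1 := max_le zero_le_one (min_le_right _ _)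

theorem rp_mono {s t : ℝ} (h : s ≤ t) : rp s ≤ rp t :=
  max_le_max le_rfl (min_le_min h le_rfl)

theorem rp_bc : BC rp := ⟨rp_cont, 1, fun t => by
  rw [abs_of_nonneg (rp_nonneg t)]; exact rp_le t⟩

noncomputable def hatf (t : ℝ) : ℝ := rp t - rp (t - 1)

theorem hatf_bc : BC hatf := rp_bc.sub (rp_bc.comp (by fun_prop))

theorem hatf_ne {t : ℝ} (h : hatf t ≠ 0) : 0 ≤ t ∧ t ≤ 2 := by
  unfold hatf at h
  constructor
  · by_contra h'
    apply h
    rw [rp_of_le, rp_of_le, sub_zero] <;> linarith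
  · by_contra h'
    apply h
    rw [rp_of_ge, rp_of_ge, sub_self] <;> linarith

/-- boxes -/
def box {n : ℕ} (b : OrthonormalBasis (Fin n) ℝ V) (l : Fin n → ℝ) : Set V :=
  {x | ∀ i, -1 ≤ inner ℝ (b i) x ∧ inner ℝ (b i) x ≤ l i}

theorem norm_le_sum {n : ℕ} (b : OrthonormalBasis (Fin n) ℝ V) (x : V) :
    ‖x‖ ≤ ∑ i, |inner ℝ (b i) x| := by
  conv_lhs => rw [← b.sum_repr' x]
  refine (norm_sum_le _ _).trans (Finset.sum_le_sum fun i _ => ?_)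
  rw [norm_smul, b.norm_eq_one, mul_one, Real.norm_eq_abs]

theorem box_body {n : ℕ} (b : OrthonormalBasis (Fin n) ℝ V) (l : Fin n → ℝ) (hl : ∀ i, 1 ≤ l i) :
    Body (box b l) := by
  refine ⟨⟨0, fun i => ?_⟩, ?_, ?_⟩
  · simp; linarith [hl i]
  · refine Metric.isCompact_of_isClosed_isBounded ?_ ?_
    · have : box b l = ⋂ i, {x | -1 ≤ inner ℝ (b i) x} ∩ {x | inner ℝ (b i) x ≤ l i} := by
        ext x; simp [box]
      rw [this]
      refine isClosed_iInter fun i => ?_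
      exact (isClosed_le (by fun_prop) (by fun_prop)).inter (isClosed_le (by fun_prop) (by fun_prop))
    · refine isBounded_iff_forall_norm_le.2 ⟨∑ i, l i, fun x hx => ?_⟩
      refine (norm_le_sum b x).trans (Finset.sum_le_sum fun i _ => ?_)
      have := hx i
      exact abs_le.2 ⟨by linarith [hl i], this.2⟩
  · intro x hx y hy s t hs ht hst i
    have h1 := hx i
    have h2 := hy i
    rw [inner_add_right, inner_smul_right, inner_smul_right]
    constructor
    · nlinarith
    · nlinarith

theorem CM.box_zero (c : CM V) (hg : ∀ K, Body K → c.I K (fun _ => 1) = 0) {n : ℕ}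
    (b : OrthonormalBasis (Fin n) ℝ V) (s : Finset (Fin n)) :
    ∀ l : Fin n → ℝ, (∀ i, 1 ≤ l i) → (∀ i ∈ s, 2 ≤ l i) →
      c.I (box b l) (fun x => ∏ i ∈ s, hatf (inner ℝ (b i) x)) = 0 := by
  classical
  induction s using Finset.induction_on with
  | empty =>
    intro l hl _
    simpa using hg _ (box_body b l hl)
  | insert j s hj ih =>
    intro l' hl' hs'
    simp only [Finset.prod_insert hj]
    -- smaller box
    set l : Fin n → ℝ := Function.update l' j (l' j - 1) with hldef
    have hlj : l j = l' j - 1 := by simp [hldef]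
    have hlne : ∀ i, i ≠ j → l i = l' i := fun i hi => by simp [hldef, hi]
    have hj2 : 2 ≤ l' j := hs' j (Finset.mem_insert_self _ _)
    have hl : ∀ i, 1 ≤ l i := by
      intro i
      by_cases hi : i = j
      · rw [hi, hlj]; linarith
      · rw [hlne i hi]; exact hl' i
    set G : V → ℝ := fun x => ∏ i ∈ s, hatf (inner ℝ (b i) x) with hG
    have hGbc : BC G := BC.prod s fun i => hatf_bc.comp (by fun_prop)
    have hs2 : ∀ i ∈ s, i ≠ j := fun i hi h => hj (h ▸ hi)
    have i1 : c.I (box b l) G = 0 := ih l hl fun i hi => by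
      rw [hlne i (hs2 i hi)]; exact hs' i (Finset.mem_insert_of_mem hi)
    have i2 : c.I (box b l') G = 0 := ih l' hl' fun i hi => hs' i (Finset.mem_insert_of_mem hi)
    have hB := box_body b l hl
    have hB' := box_body b l' hl'
    have hr0 : BC fun x : V => rp (inner ℝ (b j) x) := rp_bc.comp (by fun_prop)
    have hr1 : BC fun x : V => rp (inner ℝ (b j) x - 1) :=
      rp_bc.comp (g := fun x : V => inner ℝ (b j) x - 1) (by fun_prop)
    have h1 : c.I (box b l') (fun x => G x * (1 - rp (inner ℝ (b j) x)))
        = c.I (box b l) (fun x => G x * (1 - rp (inner ℝ (b j) x))) := by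
      refine c.loc _ _ {x | inner ℝ (b j) x < 1} hB' hB
        (isOpen_lt (by fun_prop) (by fun_prop)) ?_ _ (hGbc.mul ((BC.const 1).sub hr0)) ?_
      · ext x
        simp only [Set.mem_inter_iff, Set.mem_setOf_eq, box]
        refine and_congr_left fun hx => forall_congr' fun i => ?_
        by_cases hi : i = j
        · rw [hi, hlj]
          constructor <;> rintro ⟨a, a'⟩ <;> constructor <;> linarith
        · rw [hlne i hi]
      · intro x hx
        simp only [Set.mem_setOf_eq, not_lt] at hx
        rw [rp_of_ge hx]; simp
    have h2 : c.I (box b l') (fun x => G x * rp (inner ℝ (b j) x - 1))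
        = c.I (box b l) (fun x => G x * rp (inner ℝ (b j) x)) := by
      have t := c.trans (box b l) hB (b j) _ (hGbc.mul hr1)
      have e1 : (fun y => G (y + b j) * rp (inner ℝ (b j) (y + b j) - 1))
          = fun x => G x * rp (inner ℝ (b j) x) := by
        ext x
        have : G (x + b j) = G x := by
          simp only [hG]
          refine Finset.prod_congr rfl fun i hi => ?_
          rw [inner_add_right, b.inner_eq_zero (hs2 i hi), add_zero]
        rw [this, inner_add_right, b.inner_eq_one, add_sub_cancel_right]
      rw [e1] at t
      unfold CM.I
      rw [← t]
      refine c.loc _ _ {x | 0 < inner ℝ (b j) x} hB' (hB.translate _)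
        (isOpen_lt (by fun_prop) (by fun_prop)) ?_ _ (hGbc.mul hr1) ?_
      · ext x
        simp only [Set.mem_inter_iff, Set.mem_setOf_eq, box, mem_translate]
        refine and_congr_left fun hx => forall_congr' fun i => ?_
        by_cases hi : i = j
        · rw [hi, hlj, inner_sub_right, b.inner_eq_one]
          constructor <;> rintro ⟨a, a'⟩ <;> constructor <;> linarith
        · rw [hlne i hi, inner_sub_right, b.inner_eq_zero hi, sub_zero]
      · intro x hx
        simp only [Set.mem_setOf_eq, not_lt] at hx
        rw [rp_of_le (by linarith)]; simp
    have e2 : c.I (box b l') (fun x => hatf (inner ℝ (b j) x) * G x) =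
        c.I (box b l') G - c.I (box b l') (fun x => G x * (1 - rp (inner ℝ (b j) x)))
         - c.I (box b l') (fun x => G x * rp (inner ℝ (b j) x - 1)) := by
      unfold CM.I
      rw [← II_sub _ _ hGbc (hGbc.mul ((BC.const 1).sub hr0)), ← II_sub _ _ _ (hGbc.mul hr1)]
      · congr 1
        ext x
        unfold hatf
        ring
      · exact hGbc.sub (hGbc.mul ((BC.const 1).sub hr0))
    have e3 : c.I (box b l) G = c.I (box b l) (fun x => G x * (1 - rp (inner ℝ (b j) x)))
        + c.I (box b l) (fun x => G x * rp (inner ℝ (b j) x)) := by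
      unfold CM.I
      rw [← II_add _ _ (hGbc.mul ((BC.const 1).sub hr0)) (hGbc.mul hr0)]
      congr 1
      ext x
      ring
    change c.I (box b l') (fun x => hatf (inner ℝ (b j) x) * G x) = 0
    rw [e2, h1, h2, i2]
    rw [i1] at e3
    linarith

theorem CM.intZ_glob (c : CM V) (hg : ∀ K, Body K → c.I K (fun _ => 1) = 0) : c.IntZ := by
  let b := stdOrthonormalBasis ℝ V
  have hl : ∀ i : Fin (Module.finrank ℝ V), (1:ℝ) ≤ (fun _ => 2 : Fin (Module.finrank ℝ V) → ℝ) i := by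
    intro i; norm_num
  have hz := c.box_zero hg b Finset.univ (fun _ => 2) hl (fun i _ => le_rfl)
  have hbc : BC fun x => ∏ i, hatf (inner ℝ (b i) x) :=
    BC.prod Finset.univ fun i => hatf_bc.comp (by fun_prop)
  have hne : ∀ x, ∏ i, hatf (inner ℝ (b i) x) ≠ 0 → x ∈ box b (fun _ => 2) := by
    intro x hx i
    have := hatf_ne (Finset.prod_ne_zero_iff.1 hx i (Finset.mem_univ i))
    constructor <;> linarith
  obtain ⟨r, hr⟩ := (box_body b _ hl).2.1.isBounded.subset_ball 0
  have hz0 : ∀ x ∉ ball (0:V) r, ∏ i, hatf (inner ℝ (b i) x) = 0 := by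
    intro x hx
    by_contra h
    exact hx (hr (hne x h))
  refine c.intZ_of hbc hz0 ?_ (box_body b _ hl) hne hz
  refine (hbc.1.integral_pos_of_hasCompactSupport_nonneg_nonzero (x := ∑ i, b i) ?_ ?_ ?_).ne'
  · refine HasCompactSupport.of_support_subset_isCompact (isCompact_closedBall (0:V) r) ?_
    intro x hx
    by_contra h
    exact hx (hz0 x fun h' => h (ball_subset_closedBall h'))
  · intro x
    exact Finset.prod_nonneg fun i _ => sub_nonneg.2 (rp_mono (by linarith))
  · refine Finset.prod_ne_zero_iff.2 fun i _ => ?_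
    have : inner ℝ (b i) (∑ j, b j) = 1 := by
      rw [inner_sum, Finset.sum_eq_single i]
      · exact b.inner_eq_one i
      · intro j _ hj; exact b.inner_eq_zero hj.symm
      · simp
    rw [this]
    unfold hatf
    rw [rp_of_ge le_rfl, rp_of_le (by norm_num)]
    norm_num

end CMZ

namespace CMZ

set_option linter.unusedSectionVars false

variable {V : Type} [NormedAddCommGroup V] [InnerProductSpace ℝ V] [FiniteDimensional ℝ V]
  [MeasurableSpace V] [BorelSpace V]

open Classical in
/-- nearest point -/
noncomputable def np {V : Type} [NormedAddCommGroup V] [InnerProductSpace ℝ V] (A : Set V) (z : V) : V :=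
  if h : ∃ q ∈ A, ∀ a ∈ A, inner ℝ (z - q) (a - q) ≤ 0 then h.choose else 0

theorem np_spec {A : Set V} (hA : Body A) (z : V) :
    np A z ∈ A ∧ ∀ a ∈ A, inner ℝ (z - np A z) (a - np A z) ≤ 0 := by
  have h : ∃ q ∈ A, ∀ a ∈ A, inner ℝ (z - q) (a - q) ≤ 0 := by
    obtain ⟨q, hq, h⟩ := exists_norm_eq_iInf_of_complete_convex hA.1 hA.2.1.isComplete hA.2.2 z
    exact ⟨q, hq, (norm_eq_iInf_iff_real_inner_le_zero hA.2.2 hq).1 h⟩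
  unfold np
  rw [dif_pos h]
  exact h.choose_spec

theorem np_mem {A : Set V} (hA : Body A) (z : V) : np A z ∈ A := (np_spec hA z).1

theorem np_le {A : Set V} (hA : Body A) (z : V) {a : V} (ha : a ∈ A) :
    inner ℝ (z - np A z) (a - np A z) ≤ 0 := (np_spec hA z).2 a ha

/-- stability -/
theorem np_stab {A B : Set V} (hA : Body A) (hB : Body B) (z w : V) {δ : ℝ}
    (h1 : ∃ a ∈ A, dist (np B w) a ≤ δ) (h2 : ∃ b ∈ B, dist (np A z) b ≤ δ) :
    ‖np A z - np B w‖ ^ 2 ≤ ‖z - w‖ * ‖np A z - np B w‖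
      + δ * (‖z - np A z‖ + ‖w - np B w‖) := by
  obtain ⟨a, ha, hda⟩ := h1
  obtain ⟨b, hb, hdb⟩ := h2
  set q := np A z
  set r := np B w
  have i1 : inner ℝ (z - q) (a - q) ≤ 0 := np_le hA z ha
  have i2 : inner ℝ (w - r) (b - r) ≤ 0 := np_le hB w hb
  rw [dist_eq_norm] at hda hdb
  have i3 := real_inner_le_norm (z - w) (q - r)
  have i4 := real_inner_le_norm (z - q) (r - a)
  have i5 := real_inner_le_norm (w - r) (q - b)
  have i6 : ‖z - q‖ * ‖r - a‖ ≤ ‖z - q‖ * δ := mul_le_mul_of_nonneg_left hda (norm_nonneg _)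
  have i7 : ‖w - r‖ * ‖q - b‖ ≤ ‖w - r‖ * δ := mul_le_mul_of_nonneg_left hdb (norm_nonneg _)
  have key : ‖q - r‖ ^ 2 = inner ℝ (z - w) (q - r) + inner ℝ (z - q) (r - a) + inner ℝ (z - q) (a - q)
      + inner ℝ (w - r) (q - b) + inner ℝ (w - r) (b - r) := by
    rw [← real_inner_self_eq_norm_sq]
    simp only [inner_sub_left, inner_sub_right]
    rw [real_inner_comm q r]
    ring
  rw [key]
  linarith

theorem np_unique {A : Set V} (hA : Body A) {z q : V} (hq : q ∈ A)
    (h : ∀ a ∈ A, inner ℝ (z - q) (a - q) ≤ 0) : np A z = q := by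
  have h1 := h _ (np_mem hA z)
  have h2 := np_le hA z hq
  have : ‖np A z - q‖ ^ 2 ≤ 0 := by
    have key : ‖np A z - q‖ ^ 2 = inner ℝ (z - q) (np A z - q) + inner ℝ (z - np A z) (q - np A z) := by
      rw [← real_inner_self_eq_norm_sq]
      simp only [inner_sub_left, inner_sub_right]
      rw [real_inner_comm q (np A z)]
      ring
    linarith
  have : ‖np A z - q‖ = 0 := by nlinarith [norm_nonneg (np A z - q)]
  exact sub_eq_zero.1 (norm_eq_zero.1 this)

theorem np_lip {A : Set V} (hA : Body A) : LipschitzWith 1 (np A) := by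
  refine LipschitzWith.of_dist_le_mul fun z w => ?_
  have := np_stab hA hA z w (δ := 0) ⟨_, np_mem hA w, by simp⟩ ⟨_, np_mem hA z, by simp⟩
  rw [dist_eq_norm, dist_eq_norm]
  simp at this ⊢
  by_contra h
  push Not at h
  have h0 := norm_nonneg (z - w)
  nlinarith

theorem np_cont {A : Set V} (hA : Body A) : Continuous (np A) := (np_lip hA).continuous

theorem np_min {A : Set V} (hA : Body A) (z : V) {a : V} (ha : a ∈ A) : ‖z - np A z‖ ≤ ‖z - a‖ := by
  have h := np_le hA z ha
  have key : ‖z - a‖ ^ 2 = ‖z - np A z‖ ^ 2 - 2 * inner ℝ (z - np A z) (a - np A z) + ‖a - np A z‖ ^ 2 := by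
    rw [← norm_sub_sq_real]; congr 2; abel
  have : ‖z - np A z‖ ^ 2 ≤ ‖z - a‖ ^ 2 := by nlinarith [sq_nonneg ‖a - np A z‖]
  exact le_of_sq_le_sq this (norm_nonneg _) 

theorem np_of_mem {A : Set V} (hA : Body A) {z : V} (hz : z ∈ A) : np A z = z :=
  np_unique hA hz (by simp)

theorem infDist_np {A : Set V} (hA : Body A) (z : V) : infDist z A = ‖z - np A z‖ := by
  apply le_antisymm
  · rw [← dist_eq_norm]; exact infDist_le_dist_of_mem (np_mem hA z)
  · exact (le_infDist hA.1).2 fun {y} hy => by rw [dist_eq_norm]; exact np_min hA z hy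

theorem mem_cth {A : Set V} (hA : Body A) {ε : ℝ} (hε : 0 ≤ ε) {z : V} :
    z ∈ cthickening ε A ↔ ‖z - np A z‖ ≤ ε := by
  rw [← infDist_np hA, mem_cthickening_iff, infDist,
    ENNReal.le_ofReal_iff_toReal_le (infEDist_ne_top hA.1) hε]

theorem body_cth {A : Set V} (hA : Body A) {ε : ℝ} (hε : 0 ≤ ε) : Body (cthickening ε A) :=
  ⟨hA.1.mono (self_subset_cthickening A), hA.2.1.cthickening, hA.2.2.cthickening ε⟩

theorem np_local {A B : Set V} (hA : Body A) (hB : Body B) {U : Set V} (hU : IsOpen U)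
    (h : A ∩ U = B ∩ U) {z : V} (hz : np A z ∈ U) : np B z = np A z := by
  set q := np A z with hq
  have hqB : q ∈ B := (h ▸ (⟨np_mem hA z, hz⟩ : q ∈ A ∩ U) : q ∈ B ∩ U).1
  refine np_unique hB hqB fun a ha => ?_
  have hc : Tendsto (fun t : ℝ => q + t • (a - q)) (𝓝[>] 0) (𝓝 q) := by
    have : Continuous fun t : ℝ => q + t • (a - q) := by fun_prop
    have := this.tendsto 0
    simp at this
    exact this.mono_left nhdsWithin_le_nhds
  obtain ⟨t, ht1, ht2⟩ := ((hc.eventually (hU.mem_nhds hz)).and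
    (Ioo_mem_nhdsGT (zero_lt_one' ℝ))).exists
  have hmB : q + t • (a - q) ∈ B := hB.2.2.add_smul_sub_mem hqB ha ⟨ht2.1.le, ht2.2.le⟩
  have hmA : q + t • (a - q) ∈ A := (h.symm ▸ (⟨hmB, ht1⟩ : q + t • (a - q) ∈ B ∩ U) : _ ∈ A ∩ U).1
  have := np_le hA z hmA
  rw [← hq, add_sub_cancel_left, inner_smul_right] at this
  nlinarith [ht2.1]

theorem np_translate {A : Set V} (hA : Body A) (x z : V) :
    np ((fun y => y + x) '' A) z = np A (z - x) + x := by
  refine np_unique (hA.translate x) ⟨_, np_mem hA _, rfl⟩ ?_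
  rintro _ ⟨a, ha, rfl⟩
  have := np_le hA (z - x) ha
  have e1 : z - (np A (z - x) + x) = z - x - np A (z - x) := by abel
  have e2 : a + x - (np A (z - x) + x) = a - np A (z - x) := by abel
  simp only [e1, e2]
  exact this

theorem np_rf {A : Set V} (hA : Body A) {v : V} (hv : v ≠ 0) (z : V) :
    np (rf v '' A) z = rf v (np A (rf v z)) := by
  refine np_unique (hA.rf v) ⟨_, np_mem hA _, rfl⟩ ?_
  rintro _ ⟨a, ha, rfl⟩
  have := np_le hA (rf v z) ha
  rw [← rf_sub, ← inner_rf_left hv, rf_sub, rf_rf hv]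
  rwa [← inner_rf_rf hv, rf_sub, rf_rf hv, ← inner_rf_left hv, rf_sub, rf_rf hv] at this

theorem body_hd_ne_top {A B : Set V} (hA : Body A) (hB : Body B) : hausdorffEDist A B ≠ ⊤ :=
  hausdorffEDist_ne_top_of_nonempty_of_bounded hA.1 hB.1 hA.2.1.isBounded hB.2.1.isBounded

theorem hd_cth {A B : Set V} (hA : Body A) (hB : Body B) {ε : ℝ} (hε : 0 ≤ ε) :
    hausdorffDist (cthickening ε A) (cthickening ε B) ≤ hausdorffDist A B := by
  refine le_of_forall_gt_imp_ge_of_dense fun δ hδ => ?_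
  have key : ∀ A B : Set V, Body A → Body B → hausdorffDist A B < δ →
      ∀ x ∈ cthickening ε A, ∃ y ∈ cthickening ε B, dist x y ≤ δ := by
    intro A B hA hB hδ x hx
    obtain ⟨b, hb, hd⟩ := exists_dist_lt_of_hausdorffDist_lt (np_mem hA x) hδ (body_hd_ne_top hA hB)
    rw [mem_cth hA hε] at hx
    refine ⟨x + (b - np A x), ?_, ?_⟩
    · rw [mem_cth hB hε]
      refine (np_min hB _ hb).trans (le_of_eq_of_le ?_ hx)
      congr 1; abel
    · rw [dist_eq_norm] at hd ⊢
      have : x - (x + (b - np A x)) = np A x - b := by abel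
      rw [this]; exact hd.le
  refine hausdorffDist_le_of_mem_dist (hausdorffDist_nonneg.trans hδ.le) (key A B hA hB hδ) ?_
  exact key B A hB hA (by rwa [hausdorffDist_comm])

/-- uniform bound on convergent sequences -/
theorem CM.bound (c : CM V) {Ki : ℕ → Set V} {K : Set V} (hKi : ∀ i, Body (Ki i)) (hK : Body K)
    (ht : Tendsto (fun i => hausdorffDist (Ki i) K) atTop (𝓝 0)) :
    ∃ C, 0 ≤ C ∧ ∀ i, ∀ f, BC f → ∀ D, (∀ x, |f x| ≤ D) → |c.I (Ki i) f| ≤ C * D := by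
  have bcf : ∀ f : BoundedContinuousFunction V ℝ, BC f := fun f =>
    ⟨f.continuous, ‖f‖, fun x => f.norm_coe_le_norm x⟩
  let T : ℕ → (BoundedContinuousFunction V ℝ →L[ℝ] ℝ) := fun i =>
    LinearMap.mkContinuous
      { toFun := fun f => c.I (Ki i) f
        map_add' := fun f g => II_add _ _ (bcf f) (bcf g)
        map_smul' := fun a f => II_mul _ _ a f }
      ((c.P (Ki i)).real Set.univ + (c.N (Ki i)).real Set.univ)
      (fun f => II_bound _ _ fun x => f.norm_coe_le_norm x)
  obtain ⟨C, hC⟩ := banach_steinhaus (g := T) (fun f => by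
    have := c.cont Ki K hKi hK ht f (bcf f)
    obtain ⟨C, hC⟩ := this.norm.bddAbove_range
    exact ⟨C, fun i => hC ⟨i, rfl⟩⟩)
  refine ⟨C, (norm_nonneg _).trans (hC 0), fun i f hf D hD => ?_⟩
  have hD0 : 0 ≤ D := (abs_nonneg _).trans (hD 0)
  let F : BoundedContinuousFunction V ℝ := BoundedContinuousFunction.ofNormedAddCommGroup f hf.1 D hD
  have h1 : ‖F‖ ≤ D := BoundedContinuousFunction.norm_ofNormedAddCommGroup_le _ hD0 hD
  have h2 : ‖T i F‖ ≤ ‖T i‖ * ‖F‖ := (T i).le_opNorm F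
  have h3 : T i F = c.I (Ki i) f := rfl
  rw [h3] at h2
  exact h2.trans (mul_le_mul (hC i) h1 (norm_nonneg _) ((norm_nonneg _).trans (hC 0)))

end CMZ

namespace CMZ

set_option linter.unusedSectionVars false

variable {V : Type} [NormedAddCommGroup V] [InnerProductSpace ℝ V] [FiniteDimensional ℝ V]
  [MeasurableSpace V] [BorelSpace V]

noncomputable def dens (μ ν : Measure V) (χ : V → ℝ) : Measure V :=
  μ.withDensity (fun x => ENNReal.ofReal (χ x)) + ν.withDensity (fun x => ENNReal.ofReal (- χ x))

theorem dens_fin (μ ν : Measure V) [IsFiniteMeasure μ] [IsFiniteMeasure ν] {χ : V → ℝ} (h : BC χ) :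
    IsFiniteMeasure (dens μ ν χ) := by
  have := isFiniteMeasure_withDensity_ofReal (h.integrable μ).2
  have := isFiniteMeasure_withDensity_ofReal (h.neg.integrable ν).2
  unfold dens
  infer_instance

theorem dens_int (μ ν : Measure V) [IsFiniteMeasure μ] [IsFiniteMeasure ν] {χ f : V → ℝ} (h : BC χ)
    (hf : BC f) : ∫ x, f x ∂(dens μ ν χ) = (∫ x, max (χ x) 0 * f x ∂μ) + ∫ x, max (- χ x) 0 * f x ∂ν := by
  have := isFiniteMeasure_withDensity_ofReal (h.integrable μ).2
  have := isFiniteMeasure_withDensity_ofReal (h.neg.integrable ν).2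
  unfold dens
  rw [integral_add_measure (hf.integrable _) (hf.integrable _),
    integral_withDensity_eq_integral_toReal_smul, integral_withDensity_eq_integral_toReal_smul]
  · simp only [ENNReal.toReal_ofReal', smul_eq_mul]
  · have := h.1.measurable
    fun_prop
  · simp
  · have := h.1.measurable
    fun_prop
  · simp

theorem BC.max0 {f : V → ℝ} (hf : BC f) : BC (fun x => max (f x) 0) := by
  obtain ⟨hf, A, hA⟩ := hf
  refine ⟨by fun_prop, A, fun x => ?_⟩
  rw [abs_of_nonneg (le_max_right _ _)]
  exact max_le ((le_abs_self _).trans (hA x)) ((abs_nonneg _).trans (hA x))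

theorem dens_II (μ ν : Measure V) [IsFiniteMeasure μ] [IsFiniteMeasure ν] {χ f : V → ℝ} (h : BC χ)
    (hf : BC f) : II (dens μ ν χ) (dens ν μ χ) f = II μ ν (fun x => χ x * f x) := by
  have e : ∀ x, χ x * f x = max (χ x) 0 * f x - max (- χ x) 0 * f x := by
    intro x
    rcases le_total 0 (χ x) with h | h
    · rw [max_eq_left h, max_eq_right (by linarith)]; ring
    · rw [max_eq_right h, max_eq_left (by linarith)]; ring
  simp only [e]
  rw [II_sub _ _ (h.max0.mul hf) (h.neg.max0.mul hf)]
  unfold II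
  rw [dens_int μ ν h hf, dens_int ν μ h hf]
  ring

variable (E : Submodule ℝ V)

/-- orthogonal projection -/
noncomputable def pe (x : V) : E := E.orthogonalProjectionOnto x

theorem pe_cont : Continuous (pe E) := E.orthogonalProjectionOnto.continuous

theorem pe_add (x y : V) : pe E (x + y) = pe E x + pe E y := map_add _ _ _

theorem pe_sub (x y : V) : pe E (x - y) = pe E x - pe E y := map_sub _ _ _

theorem pe_smul (t : ℝ) (x : V) : pe E (t • x) = t • pe E x := map_smul _ _ _

theorem pe_coe (x : E) : pe E (x : V) = x := E.orthogonalProjectionOnto_mem_subspace_eq_self x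

theorem inner_pe (u : E) (x : V) : inner ℝ u (pe E x) = inner ℝ (u : V) x :=
  E.inner_orthogonalProjectionOnto_eq_of_mem_left u x

theorem norm_pe_le (x : V) : ‖pe E x‖ ≤ ‖x‖ := E.norm_orthogonalProjectionOnto_apply_le x

theorem coe_rf (v x : E) : ((rf v x : E) : V) = rf (v : V) (x : V) := by
  simp [rf]

theorem pe_rf (v : E) (x : V) : pe E (rf (v : V) x) = rf v (pe E x) := by
  unfold rf
  rw [pe_sub, pe_smul, pe_coe, ← inner_pe E v x]
  simp

noncomputable def pr (L : Set E) (x : V) : E := np L (pe E x)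

def th (ε : ℝ) (L : Set E) : Set V := cthickening ε (Subtype.val '' L)

variable {E}

theorem Body.coe {L : Set E} (hL : Body L) : Body (Subtype.val '' L : Set V) := by
  refine ⟨hL.1.image _, hL.2.1.image continuous_subtype_val, ?_⟩
  exact hL.2.2.linear_image E.subtype

theorem pr_cont {L : Set E} (hL : Body L) : Continuous (pr E L) := (np_cont hL).comp (pe_cont E)

theorem coe_pr {L : Set E} (hL : Body L) (x : V) : np (Subtype.val '' L) x = (pr E L x : V) := by
  refine np_unique hL.coe ⟨_, np_mem hL _, rfl⟩ ?_
  rintro _ ⟨a, ha, rfl⟩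
  have := np_le hL (pe E x) ha
  have e : ((a:V) - (pr E L x : V)) = ((a - pr E L x : E) : V) := rfl
  rw [e, real_inner_comm, ← inner_pe, pe_sub, pe_coe, real_inner_comm]
  exact this

theorem mem_th {L : Set E} (hL : Body L) {ε : ℝ} (hε : 0 ≤ ε) {x : V} :
    x ∈ th E ε L ↔ ‖x - pr E L x‖ ≤ ε := by
  unfold th
  rw [mem_cth hL.coe hε, coe_pr hL]

theorem th_body {L : Set E} (hL : Body L) {ε : ℝ} (hε : 0 ≤ ε) : Body (th E ε L) :=
  body_cth hL.coe hε

theorem pr_translate {L : Set E} (hL : Body L) (e : E) (x : V) :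
    pr E ((fun y => y + e) '' L) x = pr E L (x - e) + e := by
  unfold pr
  rw [np_translate hL, pe_sub, pe_coe]

theorem pr_rf {L : Set E} (hL : Body L) {v : E} (hv : v ≠ 0) (x : V) :
    pr E (rf v '' L) x = rf v (pr E L (rf (v:V) x)) := by
  unfold pr
  rw [np_rf hL hv, pe_rf]

theorem th_translate {L : Set E} (hL : Body L) {ε : ℝ} (hε : 0 ≤ ε) (e : E) :
    th E ε ((fun y => y + e) '' L) = (fun y => y + (e:V)) '' th E ε L := by
  ext x
  rw [mem_th (hL.translate e) hε, mem_translate, mem_th hL hε, pr_translate hL]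
  have : x - ((pr E L (x - e) + e : E) : V) = x - e - pr E L (x - e) := by
    push_cast; abel
  rw [this]

theorem th_rf {L : Set E} (hL : Body L) {ε : ℝ} (hε : 0 ≤ ε) {v : E} (hv : v ≠ 0) :
    th E ε (rf v '' L) = rf (v:V) '' th E ε L := by
  have hv' : (v:V) ≠ 0 := by simpa using hv
  ext x
  rw [mem_th (hL.rf v) hε, mem_rf_image hv', mem_th hL hε, pr_rf hL hv, coe_rf,
    ← norm_rf hv', rf_sub, rf_rf hv']

theorem hd_th {A B : Set E} (hA : Body A) (hB : Body B) {ε : ℝ} (hε : 0 ≤ ε) :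
    hausdorffDist (th E ε A) (th E ε B) ≤ hausdorffDist A B := by
  unfold th
  refine (hd_cth hA.coe hB.coe hε).trans (le_of_eq ?_)
  exact hausdorffDist_image isometry_subtype_coe

theorem push_loc [Nontrivial V] (c : CM V) {ε : ℝ} (hε : 0 ≤ ε) {χ : V → ℝ} (hχ : BC χ)
    {K L : Set E} {U : Set E} (hK : Body K) (hL : Body L) (hU : IsOpen U) (h : K ∩ U = L ∩ U)
    {f : E → ℝ} (hf : BC f) (hz : ∀ x ∉ U, f x = 0) :
    c.I (th E ε K) (fun x => χ x * f (pr E K x)) = c.I (th E ε L) (fun x => χ x * f (pr E L x)) := by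
  have e : (fun x => χ x * f (pr E K x)) = (fun x => χ x * f (pr E L x)) := by
    ext x
    congr 1
    by_cases h1 : pr E K x ∈ U
    · have : pr E L x = pr E K x := np_local hK hL hU h h1
      rw [this]
    · by_cases h2 : pr E L x ∈ U
      · have : pr E K x = pr E L x := np_local hL hK hU h.symm h2
        rw [this]
      · rw [hz _ h1, hz _ h2]
  have hbc : BC (fun x => χ x * f (pr E L x)) := hχ.mul (hf.comp (pr_cont hL))
  rw [e]
  refine c.loc _ _ {x | pr E L x ∈ U} (th_body hK hε) (th_body hL hε) (hU.preimage (pr_cont hL)) ?_ _ hbc ?_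
  · ext x
    simp only [Set.mem_inter_iff]
    refine and_congr_left fun hx => ?_
    have : pr E K x = pr E L x := np_local hL hK hU h.symm hx
    rw [mem_th hK hε, mem_th hL hε, this]
  · intro x hx
    rw [hz _ hx, mul_zero]

theorem push_cont [Nontrivial V] (c : CM V) {ε : ℝ} (hε : 0 ≤ ε) {χ : V → ℝ} (hχ : BC χ)
    {Ki : ℕ → Set E} {K : Set E} (hKi : ∀ i, Body (Ki i)) (hK : Body K)
    (ht : Tendsto (fun i => hausdorffDist (Ki i) K) atTop (𝓝 0))
    {f : E → ℝ} (hf : BC f) :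
    Tendsto (fun i => c.I (th E ε (Ki i)) (fun x => χ x * f (pr E (Ki i) x))) atTop
      (𝓝 (c.I (th E ε K) (fun x => χ x * f (pr E K x)))) := by
  have hTi := fun i => th_body (hKi i) hε
  have hT := th_body hK hε
  have htT : Tendsto (fun i => hausdorffDist (th E ε (Ki i)) (th E ε K)) atTop (𝓝 0) :=
    squeeze_zero (fun i => hausdorffDist_nonneg) (fun i => hd_th (hKi i) hK hε) ht
  have hg : BC fun x => χ x * f (pr E K x) := hχ.mul (hf.comp (pr_cont hK))
  have hgi : ∀ i, BC fun x => χ x * f (pr E (Ki i) x) := fun i => hχ.mul (hf.comp (pr_cont (hKi i)))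
  have h1 := c.cont _ _ hTi hT htT _ hg
  suffices h2 : Tendsto (fun i => c.I (th E ε (Ki i)) (fun x => χ x * f (pr E (Ki i) x)
      - χ x * f (pr E K x))) atTop (𝓝 0) by
    have := h2.add h1
    rw [zero_add] at this
    refine this.congr fun i => ?_
    unfold CM.I
    rw [II_sub _ _ (hgi i) hg]; ring
  obtain ⟨C, hC0, hC⟩ := c.bound hTi hT htT
  obtain ⟨R, hR⟩ := hK.2.1.isBounded.exists_norm_le
  have hR0 : 0 ≤ R := by
    obtain ⟨k, hk⟩ := hK.1
    exact (norm_nonneg k).trans (hR k hk)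
  set Q := R + 1 + ε with hQ
  -- cutoff
  let ζ : V → ℝ := fun x => rp (Q + 1 - ‖x‖)
  have hζ : BC ζ := rp_bc.comp (g := fun x : V => Q + 1 - ‖x‖) (by fun_prop)
  obtain ⟨X, hX⟩ := hχ.2
  have hX0 : 0 ≤ X := (abs_nonneg _).trans (hX 0)
  rw [Metric.tendsto_atTop]
  intro η hη
  -- uniform continuity
  have huc : UniformContinuousOn f (closedBall 0 (R + 1)) :=
    (isCompact_closedBall _ _).uniformContinuousOn_of_continuous hf.1.continuousOn
  set η' := η / (2 * (C * X + 1)) with hη'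
  have hη'0 : 0 < η' := by positivity
  obtain ⟨θ, hθ, hθf⟩ := Metric.uniformContinuousOn_iff.1 huc η' hη'0
  set M := (Q + 1 + R) + (Q + 1 + (R + 1)) with hM
  have hM0 : 0 < M := by positivity
  have hev : ∀ᶠ i in atTop, hausdorffDist (Ki i) K < min 1 (θ ^ 2 / (2 * M)) := by
    refine (tendsto_order.1 ht).2 _ ?_
    positivity
  obtain ⟨N0, hN0⟩ := eventually_atTop.1 hev
  refine ⟨N0, fun i hi => ?_⟩
  have hd := hN0 i hi
  have hd1 := hd.trans_le (min_le_left _ _)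
  have hd2 := hd.trans_le (min_le_right _ _)
  have hRi : ∀ k ∈ Ki i, ‖k‖ ≤ R + 1 := by
    intro k hk
    obtain ⟨y, hy, hyd⟩ := exists_dist_lt_of_hausdorffDist_lt hk hd1 (body_hd_ne_top (hKi i) hK)
    have := hR y hy
    rw [dist_eq_norm] at hyd
    have h3 : ‖k‖ ≤ ‖k - y‖ + ‖y‖ := by simpa using norm_add_le (k - y) y
    linarith
  have hbc := (hgi i).sub hg
  have e1 : c.I (th E ε (Ki i)) (fun x => χ x * f (pr E (Ki i) x) - χ x * f (pr E K x))
      = c.I (th E ε (Ki i)) (fun x => ζ x * (χ x * f (pr E (Ki i) x) - χ x * f (pr E K x))) := by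
    rw [← sub_eq_zero]
    unfold CM.I
    rw [← II_sub _ _ hbc (hζ.mul hbc)]
    refine c.I_supp (hTi i) (hbc.sub (hζ.mul hbc)) fun x hx => ?_
    have : ζ x = 1 := by
      refine rp_of_ge ?_
      rw [mem_th (hKi i) hε] at hx
      have h2 := hRi _ (np_mem (hKi i) (pe E x))
      have h3 : ‖x‖ ≤ ‖x - pr E (Ki i) x‖ + ‖(pr E (Ki i) x : V)‖ := by
        simpa using norm_add_le (x - pr E (Ki i) x) (pr E (Ki i) x : V)
      have h4 : ‖(pr E (Ki i) x : V)‖ ≤ R + 1 := h2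
      linarith
    rw [this]; ring
  rw [e1, dist_zero_right, Real.norm_eq_abs]
  have hb : ∀ x, |ζ x * (χ x * f (pr E (Ki i) x) - χ x * f (pr E K x))| ≤ X * η' := by
    intro x
    by_cases hx : ‖x‖ ≤ Q + 1
    · rw [← mul_sub, abs_mul, abs_mul, ← Real.dist_eq (f _)]
      have a1 : |ζ x| ≤ 1 := by
        rw [abs_of_nonneg (rp_nonneg _)]; exact rp_le _
      have m1 := np_mem (hKi i) (pe E x)
      have m2 := np_mem hK (pe E x)
      have n1 := hRi _ m1
      have n2 := hR _ m2
      have a2 : dist (f (pr E (Ki i) x)) (f (pr E K x)) < η' := by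
        refine hθf _ ?_ _ ?_ ?_
        · rw [mem_closedBall_zero_iff]; exact n1
        · rw [mem_closedBall_zero_iff]; unfold pr; linarith
        · have st := np_stab (hKi i) hK (pe E x) (pe E x) (δ := θ ^ 2 / (2 * M)) ?_ ?_
          · rw [dist_eq_norm]
            have hpe := norm_pe_le E x
            have b1 := norm_sub_le (pe E x) (np (Ki i) (pe E x))
            have b2 := norm_sub_le (pe E x) (np K (pe E x))
            rw [sub_self, norm_zero, zero_mul, zero_add] at st
            have b3 : ‖pe E x - np (Ki i) (pe E x)‖ + ‖pe E x - np K (pe E x)‖ ≤ M := by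
              rw [hM]; linarith
            have b4 : θ ^ 2 / (2 * M) * (‖pe E x - np (Ki i) (pe E x)‖ + ‖pe E x - np K (pe E x)‖)
                ≤ θ ^ 2 / (2 * M) * M := mul_le_mul_of_nonneg_left b3 (by positivity)
            have b5 : θ ^ 2 / (2 * M) * M = θ ^ 2 / 2 := by field_simp
            have b6 : ‖np (Ki i) (pe E x) - np K (pe E x)‖ ^ 2 < θ ^ 2 := by nlinarith
            exact lt_of_pow_lt_pow_left₀ 2 hθ.le b6
          · obtain ⟨y, hy, hyd⟩ := exists_dist_lt_of_hausdorffDist_lt' m2 hd2 (body_hd_ne_top (hKi i) hK)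
            exact ⟨y, hy, by rw [dist_comm]; exact hyd.le⟩
          · obtain ⟨y, hy, hyd⟩ := exists_dist_lt_of_hausdorffDist_lt m1 hd2 (body_hd_ne_top (hKi i) hK)
            exact ⟨y, hy, hyd.le⟩
      calc |ζ x| * (|χ x| * dist (f (pr E (Ki i) x)) (f (pr E K x)))
          ≤ 1 * (X * η') := by
            refine mul_le_mul a1 (mul_le_mul (hX x) a2.le dist_nonneg hX0) (by positivity) zero_le_one
        _ = X * η' := one_mul _
    · have : ζ x = 0 := rp_of_le (by linarith)
      rw [this]; simp; positivity
  refine (hC i _ (hζ.mul hbc) _ hb).trans_lt ?_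
  rw [← mul_assoc, hη', mul_div_assoc', div_lt_iff₀ (by positivity)]
  have : 0 ≤ C * X := by positivity
  nlinarith

/-- push-forward of a curvature measure to a subspace -/
noncomputable def CM.push [Nontrivial V] (c : CM V) (E : Submodule ℝ V) {ε : ℝ} (hε : 0 ≤ ε)
    {χ : V → ℝ} (hχ : BC χ) (hχE : ∀ e ∈ E, ∀ x, χ (x + e) = χ x) : CM E where
  P L := (dens (c.P (th E ε L)) (c.N (th E ε L)) χ).map (pr E L)
  N L := (dens (c.N (th E ε L)) (c.P (th E ε L)) χ).map (pr E L)
  finP L := by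
    have := dens_fin (c.P (th E ε L)) (c.N (th E ε L)) hχ
    infer_instance
  finN L := by
    have := dens_fin (c.N (th E ε L)) (c.P (th E ε L)) hχ
    infer_instance
  loc := by
    intro K L U hK hL hU h f hf hz
    have key : ∀ L, Body L → II ((dens (c.P (th E ε L)) (c.N (th E ε L)) χ).map (pr E L))
      ((dens (c.N (th E ε L)) (c.P (th E ε L)) χ).map (pr E L)) f = 
        c.I (th E ε L) (fun x => χ x * f (pr E L x)) := by
      intro L hL
      unfold CM.I
      rw [← dens_II _ _ hχ (hf.comp (pr_cont hL))]
      unfold II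
      rw [integral_map (pr_cont hL).measurable.aemeasurable hf.1.aestronglyMeasurable,
        integral_map (pr_cont hL).measurable.aemeasurable hf.1.aestronglyMeasurable]
    rw [key K hK, key L hL]
    exact push_loc c hε hχ hK hL hU h hf hz
  trans := by
    intro K hK e f hf
    have key : ∀ f : E → ℝ, BC f → ∀ L, Body L → II ((dens (c.P (th E ε L)) (c.N (th E ε L)) χ).map (pr E L))
      ((dens (c.N (th E ε L)) (c.P (th E ε L)) χ).map (pr E L)) f = 
        c.I (th E ε L) (fun x => χ x * f (pr E L x)) := by
      intro f hf L hL
      unfold CM.I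
      rw [← dens_II _ _ hχ (hf.comp (pr_cont hL))]
      unfold II
      rw [integral_map (pr_cont hL).measurable.aemeasurable hf.1.aestronglyMeasurable,
        integral_map (pr_cont hL).measurable.aemeasurable hf.1.aestronglyMeasurable]
    rw [key f hf _ (hK.translate e), key _ (hf.comp (by fun_prop)) _ hK, th_translate hK hε]
    unfold CM.I
    rw [c.trans _ (th_body hK hε) (e:V) _ (hχ.mul (hf.comp (pr_cont (hK.translate e))))]
    congr 1
    ext x
    rw [pr_translate hK, hχE _ e.2, add_sub_cancel_right]
  cont := by
    intro Ki K hKi hK ht f hf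
    have key : ∀ f : E → ℝ, BC f → ∀ L, Body L → II ((dens (c.P (th E ε L)) (c.N (th E ε L)) χ).map (pr E L))
      ((dens (c.N (th E ε L)) (c.P (th E ε L)) χ).map (pr E L)) f = 
        c.I (th E ε L) (fun x => χ x * f (pr E L x)) := by
      intro f hf L hL
      unfold CM.I
      rw [← dens_II _ _ hχ (hf.comp (pr_cont hL))]
      unfold II
      rw [integral_map (pr_cont hL).measurable.aemeasurable hf.1.aestronglyMeasurable,
        integral_map (pr_cont hL).measurable.aemeasurable hf.1.aestronglyMeasurable]
    rw [key f hf K hK]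
    exact (push_cont c hε hχ hKi hK ht hf).congr fun i => (key f hf _ (hKi i)).symm

theorem CM.I_push [Nontrivial V] (c : CM V) (E : Submodule ℝ V) {ε : ℝ} (hε : 0 ≤ ε)
    {χ : V → ℝ} (hχ : BC χ) (hχE : ∀ e ∈ E, ∀ x, χ (x + e) = χ x) {L : Set E} (hL : Body L)
    {f : E → ℝ} (hf : BC f) :
    (c.push E hε hχ hχE).I L f = c.I (th E ε L) (fun x => χ x * f (pr E L x)) := by
  unfold CM.I
  rw [← dens_II _ _ hχ (hf.comp (pr_cont hL))]
  unfold II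
  simp only [CM.push]
  rw [integral_map (pr_cont hL).measurable.aemeasurable hf.1.aestronglyMeasurable,
    integral_map (pr_cont hL).measurable.aemeasurable hf.1.aestronglyMeasurable]

theorem CM.push_inv [Nontrivial V] (c : CM V) (E : Submodule ℝ V) {ε : ℝ} (hε : 0 ≤ ε)
    {χ : V → ℝ} (hχ : BC χ) (hχE : ∀ e ∈ E, ∀ x, χ (x + e) = χ x) {σ : ℝ} (hc : c.Inv σ) :
    (c.push E hε hχ hχE).Inv σ := by
  intro v hv K hK f hf
  have hv' : (v:V) ≠ 0 := by simpa using hv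
  rw [c.I_push E hε hχ hχE (hK.rf v) hf, c.I_push E hε hχ hχE hK (hf.comp (rf_cont v)), th_rf hK hε hv,
    hc _ hv' _ (th_body hK hε) _ (hχ.mul (hf.comp (pr_cont (hK.rf v))))]
  congr 2
  ext x
  rw [pr_rf hK hv, rf_rf hv']
  congr 1
  unfold rf
  rw [sub_eq_add_neg]
  exact hχE _ (E.neg_mem (E.smul_mem _ v.2)) x

theorem CM.push_glob [Nontrivial V] (c : CM V) (E : Submodule ℝ V) {ε : ℝ} (hε : 0 ≤ ε)
    (hg : ∀ K, Body K → c.I K (fun _ => 1) = 0) :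
    ∀ K, Body K → (c.push E hε (BC.const 1) (fun _ _ _ => rfl)).I K (fun _ => 1) = 0 := by
  intro K hK
  rw [c.I_push E hε _ _ hK (BC.const 1)]
  simpa using hg _ (th_body hK hε)

end CMZ

namespace CMZ

set_option linter.unusedSectionVars false

variable {V : Type} [NormedAddCommGroup V] [InnerProductSpace ℝ V] [FiniteDimensional ℝ V]
  [MeasurableSpace V] [BorelSpace V]

theorem body_conv {S : Finset V} (hS : S.Nonempty) : Body (convexHull ℝ (S : Set V)) :=
  ⟨(convexHull_nonempty_iff).2 hS, S.finite_toSet.isCompact_convexHull (𝕜 := ℝ), convex_convexHull _ _⟩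

theorem cth_translate {A : Set V} (hA : Body A) {ε : ℝ} (hε : 0 ≤ ε) (e : V) :
    cthickening ε ((fun y => y + e) '' A) = (fun y => y + e) '' cthickening ε A := by
  ext x
  rw [mem_cth (hA.translate e) hε, mem_translate, mem_cth hA hε, np_translate hA]
  have : x - (np A (x - e) + e) = x - e - np A (x - e) := by abel
  rw [this]

theorem conv_inner_le {S : Set V} {u q : V} (h : ∀ s ∈ S, inner ℝ u (s - q) ≤ 0) :
    ∀ a ∈ convexHull ℝ S, inner ℝ u (a - q) ≤ 0 := by
  have hc : Convex ℝ {a : V | inner ℝ u (a - q) ≤ 0} := by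
    intro x hx y hy a b ha hb hab
    simp only [Set.mem_setOf_eq] at *
    have : a • x + b • y - q = a • (x - q) + b • (y - q) := by
      have : q = (a + b) • q := by rw [hab, one_smul]
      conv_lhs => rw [this]
      module
    rw [this, inner_add_right, inner_smul_right, inner_smul_right]
    nlinarith
  exact fun a ha => convexHull_min (t := {a : V | inner ℝ u (a - q) ≤ 0}) h hc ha

theorem face_mem {S : Finset V} {u p : V} (hp : p ∈ convexHull ℝ (S : Set V))
    (h : ∀ s ∈ S, inner ℝ u (s - p) ≤ 0) :
    p ∈ convexHull ℝ ((S.filter fun s => inner ℝ u (s - p) = 0 : Finset V) : Set V) := by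
  classical
  obtain ⟨w, hw0, hw1, hwp⟩ := (Finset.mem_convexHull).1 hp
  rw [Finset.centerMass_eq_of_sum_1 _ _ hw1] at hwp
  have hsum : ∑ s ∈ S, w s * inner ℝ u (s - p) = 0 := by
    have : inner ℝ u (∑ s ∈ S, w s • s - (∑ s ∈ S, w s) • p) = 0 := by
      simp only [id] at hwp
      rw [hwp, hw1, one_smul, sub_self, inner_zero_right]
    rw [Finset.sum_smul, ← Finset.sum_sub_distrib, inner_sum] at this
    rw [← this]
    refine Finset.sum_congr rfl fun s _ => ?_
    rw [← smul_sub, inner_smul_right]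
  have hz : ∀ s ∈ S, w s * inner ℝ u (s - p) = 0 :=
    (Finset.sum_eq_zero_iff_of_nonpos fun s hs =>
      mul_nonpos_of_nonneg_of_nonpos (hw0 s hs) (h s hs)).1 hsum
  have hw' : ∀ s ∈ S, ¬ inner ℝ u (s - p) = 0 → w s = 0 := fun s hs hne =>
    (mul_eq_zero.1 (hz s hs)).resolve_right hne
  refine (Finset.mem_convexHull).2 ⟨w, fun s hs => hw0 s (Finset.mem_filter.1 hs).1, ?_, ?_⟩
  · rw [Finset.sum_filter_of_ne, hw1]
    intro s hs hne
    by_contra h'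
    exact hne (hw' s hs h')
  · rw [Finset.centerMass_eq_of_sum_1]
    · rw [Finset.sum_filter_of_ne, hwp]
      intro s hs hne
      by_contra h'
      exact hne (by rw [hw' s hs h', zero_smul])
    · rw [Finset.sum_filter_of_ne, hw1]
      intro s hs hne
      by_contra h'
      exact hne (hw' s hs h')

theorem CM.face_step [Nontrivial V] (c : CM V) (hint : c.IntZ) {S : Finset V} (hS : S.Nonempty)
    {ε : ℝ} (hε : 0 < ε)
    (ih : ∀ T, T ⊂ S → T.Nonempty → ∀ f, BC f → c.I (cthickening ε (convexHull ℝ (T : Set V))) f = 0)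
    {f : V → ℝ} (hf : BC f)
    (hz : ∀ x p, p ∈ convexHull ℝ (S : Set V) → (∀ s ∈ S, inner ℝ (x - p) (s - p) = 0) →
      ‖x - p‖ = ε → f x = 0) :
    c.I (cthickening ε (convexHull ℝ (S : Set V))) f = 0 := by
  classical
  set A := convexHull ℝ (S : Set V) with hA
  have bA : Body A := body_conv hS
  have bK := body_cth bA hε.le
  refine c.I_local hf fun x0 hx0 => ?_
  rcases lt_trichotomy (‖x0 - np A x0‖) ε with hlt | heq | hgt
  · have hcont : Continuous fun x => ‖x - np A x‖ := by
      have := np_cont bA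
      fun_prop
    have hop : IsOpen {x | ‖x - np A x‖ < ε} := isOpen_lt hcont continuous_const
    refine ⟨{x | ‖x - np A x‖ < ε}, hop, hlt, fun g hg hgz => hint _ bK g hg fun x hx => ?_⟩
    refine hgz x fun hx' => hx ?_
    refine mem_interior.2 ⟨_, ?_, hop, hx'⟩
    intro y hy
    exact (mem_cth bA hε.le).2 (le_of_lt hy)
  · set p := np A x0 with hp
    have hpA : p ∈ A := np_mem bA x0
    have hle : ∀ s ∈ S, inner ℝ (x0 - p) (s - p) ≤ 0 := fun s hs =>
      np_le bA x0 (subset_convexHull ℝ _ hs)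
    set S' := S.filter fun s => inner ℝ (x0 - p) (s - p) = 0 with hS'
    have hpS' : p ∈ convexHull ℝ (S' : Set V) := face_mem hpA hle
    have hS'ne : S'.Nonempty := by
      have := (convexHull_nonempty_iff (𝕜 := ℝ)).1 ⟨p, hpS'⟩
      simpa using this
    have hss : S' ⊂ S := by
      refine (Finset.filter_subset _ _).ssubset_of_ne fun he => hx0 ?_
      refine hz x0 p hpA (fun s hs => ?_) heq
      rw [← he] at hs
      exact (Finset.mem_filter.1 hs).2
    set B := convexHull ℝ (S' : Set V) with hB
    have bB : Body B := body_conv hS'ne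
    have hBA : B ⊆ A := convexHull_mono (by exact_mod_cast hss.1)
    have hnp : np B x0 = p := np_unique bB hpS' fun a ha => np_le bA x0 (hBA ha)
    have hcB := np_cont bB
    have hop : IsOpen {x | ∀ s ∈ S \ S', inner ℝ (x - np B x) (s - np B x) < 0} := by
      have : {x | ∀ s ∈ S \ S', inner ℝ (x - np B x) (s - np B x) < 0}
          = ⋂ s ∈ S \ S', {x | inner ℝ (x - np B x) (s - np B x) < 0} := by
        ext x; simp
      rw [this]
      exact isOpen_biInter_finset fun s _ => isOpen_lt (by fun_prop) continuous_const
    refine ⟨_, hop, ?_, fun g hg hgz => ?_⟩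
    · intro s hs
      rw [hnp]
      rw [Finset.mem_sdiff] at hs
      refine lt_of_le_of_ne (hle s hs.1) fun h => hs.2 ?_
      exact Finset.mem_filter.2 ⟨hs.1, h⟩
    · have := c.loc _ _ _ bK (body_cth bB hε.le) hop ?_ g hg hgz
      · exact this.trans (ih S' hss hS'ne g hg)
      · ext x
        simp only [Set.mem_inter_iff]
        refine and_congr_left fun hx => ?_
        have : np A x = np B x := by
          refine np_unique bA (hBA (np_mem bB x)) (conv_inner_le fun s hs => ?_)
          by_cases h : s ∈ S'
          · exact np_le bB x (subset_convexHull ℝ _ h)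
          · exact (hx s (Finset.mem_sdiff.2 ⟨hs, h⟩)).le
        rw [mem_cth bA hε.le, mem_cth bB hε.le, this]
  · refine ⟨(cthickening ε A)ᶜ, isClosed_cthickening.isOpen_compl, ?_, fun g hg hgz => ?_⟩
    · intro h
      rw [mem_cth bA hε.le] at h
      linarith
    · exact c.I_supp bK hg fun x hx => hgz x fun h => h hx

/-- the analytic step -/
def CM.Step (c : CM V) : Prop :=
  ∀ (E : Submodule ℝ V) (L : Set E), Body L → ∀ ε : ℝ, 0 < ε →
    (∀ f, BC f → (∀ x, pe E x ∈ L → ‖x - pe E x‖ = ε → f x = 0) → c.I (th E ε L) f = 0) →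
    ∀ f, BC f → c.I (th E ε L) f = 0

theorem CM.poly_zero [Nontrivial V] (c : CM V) (hint : c.IntZ) (hst : c.Step) {ε : ℝ} (hε : 0 < ε)
    (S : Finset V) : S.Nonempty → ∀ f, BC f → c.I (cthickening ε (convexHull ℝ (S : Set V))) f = 0 := by
  induction S using Finset.strongInduction with
  | H S ih =>
    intro hS f hf
    obtain ⟨s0, hs0⟩ := hS
    set A := convexHull ℝ (S : Set V) with hA
    have bA : Body A := body_conv ⟨s0, hs0⟩
    let E : Submodule ℝ V := Submodule.span ℝ ((fun s => s - s0) '' (S : Set V))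
    have hAE : ∀ a ∈ A, a - s0 ∈ E := by
      have hc : Convex ℝ {y : V | y - s0 ∈ E} := by
        have := E.convex.translate_preimage_right (-s0)
        simpa [Set.preimage, sub_eq_add_neg, add_comm] using this
      intro a ha
      refine convexHull_min (t := {y : V | y - s0 ∈ E}) (fun s hs => ?_) hc ha
      exact Submodule.subset_span ⟨s, hs, rfl⟩
    let L : Set E := {y | (y : V) + s0 ∈ A}
    have hLA : (fun y => y + s0) '' (Subtype.val '' L) = A := by
      ext y
      rw [mem_translate]
      constructor
      · rintro ⟨z, hz, hzy⟩
        have : (z:V) + s0 ∈ A := hz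
        rwa [hzy, sub_add_cancel] at this
      · intro hy
        exact ⟨⟨y - s0, hAE y hy⟩, by simpa [L] using hy, rfl⟩
    have bL : Body L := by
      refine ⟨⟨0, by simpa [L] using subset_convexHull ℝ _ hs0⟩, ?_, ?_⟩
      · have e1 : L = (fun y : E => (y : V) + s0) ⁻¹' A := rfl
        rw [e1]
        refine Topology.IsClosedEmbedding.isCompact_preimage ?_ bA.2.1
        exact (Homeomorph.addRight s0).isClosedEmbedding.comp
          E.closed_of_finiteDimensional.isClosedEmbedding_subtypeVal
      · intro x hx y hy a b ha hb hab
        have := bA.2.2 (x := (x:V) + s0) hx (y := (y:V) + s0) hy ha hb hab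
        change ((a • x + b • y : E) : V) + s0 ∈ A
        convert this using 1
        have : s0 = (a + b) • s0 := by rw [hab, one_smul]
        conv_lhs => rw [this]
        push_cast
        module
    have hK : cthickening ε A = (fun y => y + s0) '' th E ε L := by
      unfold th
      rw [← cth_translate bL.coe hε.le, hLA]
    have htr : ∀ g, BC g → c.I (cthickening ε A) g = c.I (th E ε L) (fun y => g (y + s0)) := by
      intro g hg
      rw [hK]
      exact c.trans _ (th_body bL hε.le) s0 g hg
    rw [htr f hf]
    refine hst E L bL ε hε (fun g hg hgz => ?_) _ (hf.comp (by fun_prop))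
    have hg' : BC fun x => g (x - s0) := hg.comp (by fun_prop)
    have e2 := htr _ hg'
    simp only [add_sub_cancel_right] at e2
    rw [← e2]
    refine c.face_step hint ⟨s0, hs0⟩ hε (fun T hT hTn => ih T hT hTn) hg' fun x p hp hperp hn => ?_
    have hperp' : ∀ e ∈ E, inner ℝ (x - p) e = 0 := by
      intro e he
      refine Submodule.span_induction (p := fun e _ => inner ℝ (x - p) e = 0) ?_ ?_ ?_ ?_ he
      · rintro _ ⟨s, hs, rfl⟩
        have h1 := hperp s hs
        have h2 := hperp s0 hs0
        have : s - s0 = (s - p) - (s0 - p) := by abel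
        simp only [this]
        rw [inner_sub_right, h1, h2, sub_zero]
      · simp
      · intro a b _ _ ha hb
        rw [inner_add_right, ha, hb, add_zero]
      · intro t a _ ha
        rw [inner_smul_right, ha, mul_zero]
    have hpe0 : pe E (x - p) = 0 := by
      refine ext_inner_left ℝ fun v => ?_
      rw [inner_pe, inner_zero_right, real_inner_comm]
      exact hperp' v v.2
    have hpe : pe E (x - s0) = ⟨p - s0, hAE p hp⟩ := by
      have : x - s0 = (x - p) + ((⟨p - s0, hAE p hp⟩ : E) : V) := by simp
      rw [this, pe_add, hpe0, zero_add, pe_coe]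
    refine hgz _ ?_ ?_
    · rw [hpe]
      simpa [L] using hp
    · rw [hpe]
      simpa using hn

theorem CM.dense_zero [Nontrivial V] (c : CM V)
    (h : ∀ ε : ℝ, 0 < ε → ∀ S : Finset V, S.Nonempty → ∀ f, BC f →
      c.I (cthickening ε (convexHull ℝ (S : Set V))) f = 0) :
    ∀ K, Body K → ∀ f, BC f → c.I K f = 0 := by
  intro K hK f hf
  have hex : ∀ i : ℕ, ∃ S : Finset V, S.Nonempty ∧ hausdorffDist
      (cthickening (1 / ((i:ℝ) + 1)) (convexHull ℝ (S : Set V))) K ≤ 1 / ((i:ℝ) + 1) := by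
    intro i
    have hε : 0 < 1 / ((i:ℝ) + 1) := by positivity
    obtain ⟨t, htK, htf, htc⟩ := hK.2.1.finite_cover_balls hε
    lift t to Finset V using htf
    have hne : t.Nonempty := by
      obtain ⟨k, hk⟩ := hK.1
      have := htc hk
      simp only [Set.mem_iUnion] at this
      obtain ⟨s, hs, _⟩ := this
      exact ⟨s, hs⟩
    have bS := body_conv hne
    refine ⟨t, hne, hausdorffDist_le_of_mem_dist hε.le ?_ ?_⟩
    · intro x hx
      rw [mem_cth bS hε.le, ← dist_eq_norm] at hx
      exact ⟨_, convexHull_min htK hK.2.2 (np_mem bS x), hx⟩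
    · intro x hx
      have := htc hx
      simp only [Set.mem_iUnion] at this
      obtain ⟨s, hs, hd⟩ := this
      exact ⟨s, self_subset_cthickening _ (subset_convexHull ℝ _ hs), (mem_ball.1 hd).le⟩
  choose S hS hd using hex
  have hl := c.cont (fun i => cthickening (1 / ((i:ℝ) + 1)) (convexHull ℝ (S i : Set V))) K
    (fun i => body_cth (body_conv (hS i)) (by positivity)) hK
    (squeeze_zero (fun _ => hausdorffDist_nonneg) hd tendsto_one_div_add_atTop_nhds_zero_nat) f hf
  refine tendsto_nhds_unique hl ?_
  have : ∀ i : ℕ, II (c.P (cthickening (1 / ((i:ℝ) + 1)) (convexHull ℝ (S i : Set V))))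
      (c.N (cthickening (1 / ((i:ℝ) + 1)) (convexHull ℝ (S i : Set V)))) f = 0 :=
    fun i => h _ (by positivity) _ (hS i) f hf
  simp only [this]
  exact tendsto_const_nhds

theorem CM.zero_of_step [Nontrivial V] (c : CM V) (hint : c.IntZ) (hst : c.Step) :
    ∀ K, Body K → ∀ f, BC f → c.I K f = 0 :=
  c.dense_zero fun _ hε S hS f hf => c.poly_zero hint hst hε S hS f hf

end CMZ

namespace CMZ

set_option linter.unusedSectionVars false

variable {V : Type} [NormedAddCommGroup V] [InnerProductSpace ℝ V] [FiniteDimensional ℝ V]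
  [MeasurableSpace V] [BorelSpace V]

noncomputable def rfE {v : V} (hv : v ≠ 0) : V ≃ₗᵢ[ℝ] V where
  toFun := rf v
  invFun := rf v
  map_add' := rf_add v
  map_smul' := fun t x => rf_smul v t x
  left_inv := rf_rf hv
  right_inv := rf_rf hv
  norm_map' := norm_rf hv

theorem integral_rf {v : V} (hv : v ≠ 0) (f : V → ℝ) : ∫ z, f (rf v z) = ∫ z, f z :=
  (rfE hv).measurePreserving.integral_comp (rfE hv).toHomeomorph.measurableEmbedding f

theorem pe_orth {E : Submodule ℝ V} {v : V} (hv : v ∈ Eᗮ) : pe E v = 0 := by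
  refine ext_inner_left ℝ fun e => ?_
  rw [inner_pe, inner_zero_right]
  exact (Submodule.mem_orthogonal E v).1 hv _ e.2

theorem pe_rf_orth {E : Submodule ℝ V} {v : V} (hv : v ∈ Eᗮ) (x : V) : pe E (rf v x) = pe E x := by
  unfold rf
  rw [pe_sub, pe_smul, pe_orth hv, smul_zero, sub_zero]

theorem sub_pe_mem {E : Submodule ℝ V} (x : V) : x - pe E x ∈ Eᗮ := by
  rw [Submodule.mem_orthogonal]
  intro e he
  have := inner_pe E ⟨e, he⟩ x
  rw [inner_sub_right, ← this]
  simp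

theorem th_rf_orth {E : Submodule ℝ V} {L : Set E} (hL : Body L) {ε : ℝ} (hε : 0 ≤ ε) {v : V}
    (hv : v ≠ 0) (hvE : v ∈ Eᗮ) : rf v '' th E ε L = th E ε L := by
  ext x
  rw [mem_rf_image hv, mem_th hL hε, mem_th hL hε]
  have e1 : pr E L (rf v x) = pr E L x := by unfold pr; rw [pe_rf_orth hvE]
  have e2 : rf v (pr E L x : V) = pr E L x := by
    apply rf_of_inner
    rw [real_inner_comm]
    exact (Submodule.mem_orthogonal E v).1 hvE _ (pr E L x).2
  rw [e1]
  conv_lhs => rw [← e2, ← rf_sub, norm_rf hv]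

theorem swap_lem (μ : Measure V) [IsFiniteMeasure μ] {W : Type} [NormedAddCommGroup W]
    [InnerProductSpace ℝ W] [FiniteDimensional ℝ W] [MeasurableSpace W] [BorelSpace W]
    {ψ : W → ℝ} (hψ : BC ψ) {r : ℝ} (hψz : ∀ x ∉ ball (0:W) r, ψ x = 0)
    {F : V → W → ℝ} (hF : Continuous (Function.uncurry F)) {C : ℝ} (hC : ∀ x z, |F x z| ≤ C) :
    Integrable (fun z => ψ z * ∫ x, F x z ∂μ) ∧
    ∫ z, ψ z * ∫ x, F x z ∂μ = ∫ x, (∫ z, ψ z * F x z) ∂μ := by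
  have hψi := integrable_of_supp hψ hψz
  have hint : Integrable (Function.uncurry fun (x : V) (z : W) => ψ z * F x z) (μ.prod volume) := by
    have h1 : Integrable (fun p : V × W => C * ψ p.2) (μ.prod volume) :=
      (hψi.comp_snd μ).const_mul C
    refine h1.mono ?_ ?_
    · have := hψ.1
      have : Continuous fun p : V × W => F p.1 p.2 := hF
      exact Continuous.aestronglyMeasurable (by unfold Function.uncurry; fun_prop)
    · refine ae_of_all _ fun p => ?_
      simp only [Function.uncurry, norm_mul, Real.norm_eq_abs]
      rw [mul_comm]
      refine mul_le_mul_of_nonneg_right ((hC _ _).trans (le_abs_self C)) (abs_nonneg _)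
  constructor
  · have := hint.integral_prod_right
    simpa only [Function.uncurry, integral_const_mul] using this
  · rw [integral_integral_swap hint]
    simp only [integral_const_mul]

theorem int_cont {μ : Measure V} {W : Type} [TopologicalSpace W] [FirstCountableTopology W]
    {ψ : V → ℝ} (hψ : Integrable ψ μ) (hψc : Continuous ψ)
    {F : V → W → ℝ} (hF : Continuous (Function.uncurry F)) {C : ℝ} (hC : ∀ x z, |F x z| ≤ C) :
    BC (fun z => ∫ x, ψ x * F x z ∂μ) := by
  have hb : ∀ x z, ‖ψ x * F x z‖ ≤ ‖ψ x‖ * C := fun x z => by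
    rw [norm_mul]
    exact mul_le_mul_of_nonneg_left (hC x z) (norm_nonneg _)
  refine ⟨?_, ∫ x, ‖ψ x‖ * C ∂μ, fun z => ?_⟩
  · refine continuous_of_dominated (bound := fun x => ‖ψ x‖ * C) ?_ ?_ ?_ ?_
    · intro z
      have : Continuous fun x => F x z := hF.comp (by fun_prop : Continuous fun x => (x, z))
      exact (hψc.mul this).aestronglyMeasurable
    · exact fun z => ae_of_all _ fun x => hb x z
    · exact hψ.norm.mul_const C
    · refine ae_of_all _ fun x => ?_
      have : Continuous fun z => F x z := hF.comp (by fun_prop : Continuous fun z => (x, z))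
      exact continuous_const.mul this
  · exact norm_integral_le_of_norm_le (hψ.norm.mul_const C) (ae_of_all _ fun x => hb x z)

/-- the Fourier step -/
theorem CM.fourier [Nontrivial V] (c : CM V) (hc : c.Inv 1) {E : Submodule ℝ V} {L : Set E}
    (hL : Body L) {ε : ℝ} (hε : 0 < ε)
    (hX : ∀ f, BC f → (∀ x, pe E x ∈ L → ‖x - pe E x‖ = ε → f x = 0) → c.I (th E ε L) f = 0)
    (hP : ∀ g : E → ℝ, BC g → c.I (th E ε L) (fun x => g (pr E L x)) = 0)
    {g : E → ℝ} (hg : BC g) {h : ℝ → ℝ} (hh : BC h) (z0 : Eᗮ) :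
    c.I (th E ε L) (fun x => g (pe E x) * h (inner ℝ x (z0 : V))) = 0 := by
  set K := th E ε L with hK
  have bK : Body K := th_body hL hε.le
  -- functions of the projection
  have hG : BC fun x => g (pe E x) := hg.comp (pe_cont E)
  have hPe : c.I K (fun x => g (pe E x)) = 0 := by
    have h2 : BC fun x => g (pr E L x) := hg.comp (pr_cont hL)
    have := hX _ (hG.sub h2) (fun x hx _ => by
      have : pr E L x = pe E x := np_of_mem hL hx
      rw [this, sub_self])
    unfold CM.I at this
    rw [II_sub _ _ hG h2] at this
    have h3 := hP g hg
    unfold CM.I at h3 ⊢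
    linarith
  obtain ⟨Cg, hCg⟩ := hg.2
  obtain ⟨Ch, hCh⟩ := hh.2
  let F : V → Eᗮ → ℝ := fun x z => h (inner ℝ x (z : V))
  have hFc : Continuous (Function.uncurry F) := by
    have := hh.1
    unfold Function.uncurry
    exact this.comp (by fun_prop)
  have hFb : ∀ x z, |F x z| ≤ Ch := fun x z => hCh _
  have hFx : ∀ z, BC fun x => F x z := fun z =>
    ⟨hFc.comp (by fun_prop : Continuous fun x : V => (x, z)), Ch, fun x => hFb x z⟩
  let D : Eᗮ → ℝ := fun z => c.I K (fun x => g (pe E x) * F x z)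
  have hD : BC D :=
    (int_cont (hG.integrable _) hG.1 hFc hFb).sub (int_cont (hG.integrable _) hG.1 hFc hFb)
  have hDrf : ∀ v : Eᗮ, v ≠ 0 → ∀ z, D (rf v z) = D z := by
    intro v hv z
    have hv' : (v:V) ≠ 0 := by simpa using hv
    have := hc (v:V) hv' K bK _ (hG.mul (hFx z))
    rw [hK, th_rf_orth hL hε.le hv' v.2, ← hK, one_mul] at this
    change c.I K (fun x => g (pe E x) * F x (rf v z)) = c.I K (fun x => g (pe E x) * F x z)
    rw [this]
    congr 1
    ext x
    rw [pe_rf_orth v.2]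
    congr 1
    simp only [F]
    rw [coe_rf, inner_rf_left hv']
  -- weight
  set R := ‖z0‖ + 1 with hR
  let w : Eᗮ → ℝ := fun z => rp (R - ‖z‖)
  have hw : BC w := rp_bc.comp (g := fun z : Eᗮ => R - ‖z‖) (by fun_prop)
  have hwz : ∀ z ∉ ball (0:Eᗮ) R, w z = 0 := by
    intro z hz
    rw [mem_ball_zero_iff, not_lt] at hz
    exact rp_of_le (by linarith)
  have hψ : BC fun z => w z * D z := hw.mul hD
  have hψz : ∀ z ∉ ball (0:Eᗮ) R, w z * D z = 0 := fun z hz => by rw [hwz z hz, zero_mul]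
  have hψi := integrable_of_supp hψ hψz
  let k : V → ℝ := fun x => ∫ z, (w z * D z) * F x z
  have hkbc : BC k := by
    refine int_cont (F := fun z x => F x z) hψi hψ.1 ?_ (fun z x => hFb x z)
    exact hFc.comp continuous_swap
  have hkrf : ∀ v : Eᗮ, v ≠ 0 → ∀ x, k (rf (v:V) x) = k x := by
    intro v hv x
    have hv' : (v:V) ≠ 0 := by simpa using hv
    simp only [k]
    rw [← integral_rf hv (fun z => w z * D z * F x z)]
    congr 1
    ext z
    rw [hDrf v hv]
    simp only [w, F]
    rw [norm_rf hv, coe_rf, inner_rf_left hv']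
  have hkpe : ∀ x x', x - pe E x = x' - pe E x' → k x = k x' := by
    intro x x' hxx
    simp only [k, F]
    congr 1
    ext z
    congr 2
    have e1 : ∀ x : V, inner ℝ x (z:V) = inner ℝ (x - pe E x) (z:V) := by
      intro x
      rw [inner_sub_left, (Submodule.mem_orthogonal E z).1 z.2 _ (pe E x).2, sub_zero]
    rw [e1 x, e1 x', hxx]
  have hkX : ∀ x x', ‖x - pe E x‖ = ε → ‖x' - pe E x'‖ = ε → k x = k x' := by
    intro x x' h1 h2
    by_cases hne : x - pe E x = x' - pe E x'
    · exact hkpe x x' hne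
    · have hsw := rf_swap (h1.trans h2.symm) hne
      set v : Eᗮ := ⟨(x - pe E x) - (x' - pe E x'), Eᗮ.sub_mem (sub_pe_mem x) (sub_pe_mem x')⟩ with hv
      have hv0 : v ≠ 0 := by
        intro h0
        apply hne
        rw [← sub_eq_zero]
        exact congrArg Subtype.val h0
      rw [← hkrf v hv0 x]
      refine hkpe _ _ ?_
      rw [pe_rf_orth v.2]
      have e2 : rf (v:V) (pe E x : V) = pe E x := by
        apply rf_of_inner
        rw [real_inner_comm]
        exact (Submodule.mem_orthogonal E v).1 v.2 _ (pe E x).2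
      rw [← hsw]
      conv_lhs => rw [← e2, ← rf_sub]
  -- the integral of the square
  have hsq : ∫ z, w z * D z * D z = 0 := by
    have e1 : ∫ z, w z * D z * D z = c.I K (fun x => g (pe E x) * k x) := by
      have hF2 : Continuous (Function.uncurry fun x z => g (pe E x) * F x z) :=
        (hG.1.comp continuous_fst).mul hFc
      have hb2 : ∀ x z, |g (pe E x) * F x z| ≤ Cg * Ch := fun x z => by
        rw [abs_mul]
        exact mul_le_mul (hCg _) (hFb x z) (abs_nonneg _) ((abs_nonneg _).trans (hCg 0))
      have s1 := swap_lem (c.P K) hψ hψz hF2 hb2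
      have s2 := swap_lem (c.N K) hψ hψz hF2 hb2
      have e3 : ∀ x, g (pe E x) * k x = ∫ z, w z * D z * (g (pe E x) * F x z) := by
        intro x
        simp only [k]
        rw [← integral_const_mul]
        congr 1
        ext z
        ring
      unfold CM.I II
      simp only [e3]
      rw [← s1.2, ← s2.2, ← integral_sub s1.1 s2.1]
      congr 1
      ext z
      rw [← mul_sub]
      rfl
    rw [e1]
    by_cases hne : ∃ x1, pe E x1 ∈ L ∧ ‖x1 - pe E x1‖ = ε
    · obtain ⟨x1, hx1, hx1'⟩ := hne
      have h1 := hX _ ((hG.mul hkbc).sub ((BC.const (k x1)).mul hG)) (fun x _ hx' => by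
        rw [hkX x x1 hx' hx1']; ring)
      unfold CM.I at h1 hPe ⊢
      rw [II_sub _ _ (hG.mul hkbc) ((BC.const (k x1)).mul hG), II_mul, hPe] at h1
      linarith
    · exact hX _ (hG.mul hkbc) (fun x h1 h2 => absurd ⟨x, h1, h2⟩ hne)
  change D z0 = 0
  by_contra hne
  have hcs : Continuous fun z => w z * D z * D z := (hψ.mul hD).1
  refine absurd hsq (hcs.integral_pos_of_hasCompactSupport_nonneg_nonzero (x := z0) ?_ ?_ ?_).ne'
  · refine HasCompactSupport.of_support_subset_isCompact (isCompact_closedBall (0:Eᗮ) R) ?_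
    intro x hx
    by_contra h
    refine hx ?_
    have := hψz x fun h' => h (ball_subset_closedBall h')
    change w x * D x * D x = 0
    rw [this, zero_mul]
  · intro z
    change 0 ≤ w z * D z * D z
    rw [mul_assoc]
    exact mul_nonneg (rp_nonneg _) (mul_self_nonneg _)
  · have : w z0 = 1 := rp_of_ge (by rw [hR]; linarith)
    rw [this, one_mul]
    exact mul_self_ne_zero.2 hne

theorem eq_of_trig (μ ν : Measure V) [IsFiniteMeasure μ] [IsFiniteMeasure ν]
    (h1 : ∀ y : V, II μ ν (fun x => Real.cos (inner ℝ x y)) = 0)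
    (h2 : ∀ y : V, II μ ν (fun x => Real.sin (inner ℝ x y)) = 0) : μ = ν := by
  refine Measure.ext_of_charFun ?_
  ext y
  have key : ∀ ρ : Measure V, IsFiniteMeasure ρ → charFun ρ y =
      ((∫ x, Real.cos (inner ℝ x y) ∂ρ : ℝ) : ℂ) + ((∫ x, Real.sin (inner ℝ x y) ∂ρ : ℝ) : ℂ) * Complex.I := by
    intro ρ _
    have b1 : BC fun x : V => Real.cos (inner ℝ x y) :=
      ⟨by fun_prop, 1, fun x => Real.abs_cos_le_one _⟩
    have b2 : BC fun x : V => Real.sin (inner ℝ x y) :=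
      ⟨by fun_prop, 1, fun x => Real.abs_sin_le_one _⟩
    rw [charFun_apply, ← integral_complex_ofReal, ← integral_complex_ofReal, ← integral_mul_const, ← integral_add]
    · congr 1
      ext x
      rw [Complex.exp_mul_I]
      simp
    · exact (b1.integrable ρ).ofReal
    · exact (b2.integrable ρ).ofReal.mul_const _
  have a1 := h1 y
  have a2 := h2 y
  unfold II at a1 a2
  rw [key μ inferInstance, key ν inferInstance, sub_eq_zero.1 a1, sub_eq_zero.1 a2]

theorem bc_cos : BC Real.cos := ⟨Real.continuous_cos, 1, Real.abs_cos_le_one⟩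
theorem bc_sin : BC Real.sin := ⟨Real.continuous_sin, 1, Real.abs_sin_le_one⟩

theorem inner_split {E : Submodule ℝ V} (x y : V) :
    inner ℝ x y = inner ℝ (pe E x) (pe E y) + inner ℝ x (y - pe E y) := by
  have : inner ℝ (pe E x) (pe E y) = inner ℝ x (pe E y : V) := by
    rw [real_inner_comm, inner_pe, real_inner_comm]
  rw [this, ← inner_add_right]
  simp

theorem CM.O_step [Nontrivial V] (c : CM V) (hc : c.Inv 1) {E : Submodule ℝ V} {L : Set E}
    (hL : Body L) {ε : ℝ} (hε : 0 < ε)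
    (hX : ∀ f, BC f → (∀ x, pe E x ∈ L → ‖x - pe E x‖ = ε → f x = 0) → c.I (th E ε L) f = 0)
    (hP : ∀ g : E → ℝ, BC g → c.I (th E ε L) (fun x => g (pr E L x)) = 0) 
    {f : V → ℝ} (_ : BC f) : c.I (th E ε L) f = 0 := by
  have hE : c.P (th E ε L) = c.N (th E ε L) := by
    have T : ∀ (a b : ℝ → ℝ), BC a → BC b → ∀ y : V, BC (fun x => a (inner ℝ (pe E x) (pe E y)) * b (inner ℝ x (y - pe E y)))
        ∧ II (c.P (th E ε L)) (c.N (th E ε L))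
          (fun x => a (inner ℝ (pe E x) (pe E y)) * b (inner ℝ x (y - pe E y))) = 0 := by
      intro a b ha hb y
      have hga : BC fun e : E => a (inner ℝ e (pe E y)) := ha.comp (by fun_prop)
      refine ⟨(hga.comp (pe_cont E)).mul (hb.comp (by fun_prop)), ?_⟩
      exact c.fourier hc hL hε hX hP hga hb ⟨y - pe E y, sub_pe_mem y⟩
    refine eq_of_trig _ _ (fun y => ?_) (fun y => ?_)
    · have t1 := T _ _ bc_cos bc_cos y
      have t2 := T _ _ bc_sin bc_sin y
      have e : ∀ x, Real.cos (inner ℝ x y) = Real.cos (inner ℝ (pe E x) (pe E y)) * Real.cos (inner ℝ x (y - pe E y))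
        - Real.sin (inner ℝ (pe E x) (pe E y)) * Real.sin (inner ℝ x (y - pe E y)) := by
        intro x
        rw [inner_split (E := E) x y, Real.cos_add]
      simp only [e]
      rw [II_sub _ _ t1.1 t2.1, t1.2, t2.2, sub_zero]
    · have t1 := T _ _ bc_sin bc_cos y
      have t2 := T _ _ bc_cos bc_sin y
      have e : ∀ x, Real.sin (inner ℝ x y) = Real.sin (inner ℝ (pe E x) (pe E y)) * Real.cos (inner ℝ x (y - pe E y))
        + Real.cos (inner ℝ (pe E x) (pe E y)) * Real.sin (inner ℝ x (y - pe E y)) := by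
        intro x
        rw [inner_split (E := E) x y, Real.sin_add]
      simp only [e]
      rw [II_add _ _ t1.1 t2.1, t1.2, t2.2, add_zero]
  unfold CM.I II
  rw [hE, sub_self]

theorem top_step (c : CM V) {E : Submodule ℝ V} (hE : E = ⊤) {L : Set E} {ε : ℝ} (hε : 0 < ε)
    (hX : ∀ f, BC f → (∀ x, pe E x ∈ L → ‖x - pe E x‖ = ε → f x = 0) → c.I (th E ε L) f = 0)
    {f : V → ℝ} (hf : BC f) : c.I (th E ε L) f = 0 := by
  refine hX f hf fun x _ hx => ?_
  exfalso
  have h1 : (pe E x : V) = x := by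
    have := pe_coe E ⟨x, hE ▸ Submodule.mem_top⟩
    exact congrArg Subtype.val this
  rw [h1] at hx
  simp at hx
  linarith

theorem O_zero (n : ℕ) : ∀ (V : Type) [NormedAddCommGroup V] [InnerProductSpace ℝ V]
    [FiniteDimensional ℝ V] [MeasurableSpace V] [BorelSpace V], Module.finrank ℝ V = n →
    ∀ c : CM V, c.Inv 1 → (∀ K, Body K → c.I K (fun _ => 1) = 0) →
    ∀ K, Body K → ∀ f, BC f → c.I K f = 0 := by
  induction n using Nat.strong_induction_on with
  | _ n ih =>
    intro V _ _ _ _ _ hn c hc hg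
    rcases subsingleton_or_nontrivial V with hV | hV
    · intro K hK f hf
      have : f = fun x => f 0 * 1 := by
        ext x
        rw [Subsingleton.elim x 0, mul_one]
      rw [this]
      unfold CM.I
      rw [II_mul]
      have := hg K hK
      unfold CM.I at this
      rw [this, mul_zero]
    · refine c.zero_of_step (c.intZ_glob hg) ?_
      intro E L hL ε hε hX f hf
      by_cases hE : E = ⊤
      · exact top_step c hE hε hX hf
      · refine c.O_step hc hL hε hX (fun g hgb => ?_) hf
        have hlt : Module.finrank ℝ E < n := hn ▸ Submodule.finrank_lt hE
        have := ih _ hlt E rfl (c.push E hε.le (BC.const 1) (fun _ _ _ => rfl))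
          (c.push_inv E hε.le _ _ hc) (c.push_glob E hε.le hg) L hL g hgb
        rw [c.I_push E hε.le _ _ hL hgb] at this
        simpa using this

end CMZ

namespace CMZ

set_option linter.unusedSectionVars false

variable {V : Type} [NormedAddCommGroup V] [InnerProductSpace ℝ V] [FiniteDimensional ℝ V]
  [MeasurableSpace V] [BorelSpace V]

theorem CM.anti_orth (c : CM V) (hc : c.Inv (-1)) {E : Submodule ℝ V} {L : Set E}
    (hL : Body L) {ε : ℝ} (hε : 0 < ε) {v : V} (hv : v ≠ 0) (hvE : v ∈ Eᗮ) {f : V → ℝ} (hf : BC f)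
    (hfv : ∀ x, f (rf v x) = f x) : c.I (th E ε L) f = 0 := by
  have := hc v hv _ (th_body hL hε.le) f hf
  rw [th_rf_orth hL hε.le hv hvE] at this
  simp only [hfv] at this
  linarith

theorem CM.anti_two (c : CM V) (hc : c.Inv (-1)) {E : Submodule ℝ V} {L : Set E}
    (hL : Body L) {ε : ℝ} (hε : 0 < ε) (hE : 2 ≤ Module.finrank ℝ Eᗮ) {f : V → ℝ} :
    c.I (th E ε L) f = 0 := by
  have hex : ∀ y : V, ∃ v : V, v ≠ 0 ∧ v ∈ Eᗮ ∧ ∀ x, inner ℝ (rf v x) y = inner ℝ x y := by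
    intro y
    let T : Eᗮ →ₗ[ℝ] ℝ := (innerₛₗ ℝ y).comp Eᗮ.subtype
    have hk : T.ker ≠ ⊥ := LinearMap.ker_ne_bot_of_finrank_lt (by
      rw [Module.finrank_self]; omega)
    obtain ⟨v, hvk, hv⟩ := Submodule.exists_mem_ne_zero_of_ne_bot hk
    have hv' : (v:V) ≠ 0 := by simpa using hv
    refine ⟨v, hv', v.2, fun x => ?_⟩
    rw [inner_rf_left hv', rf_of_inner]
    rw [real_inner_comm]
    exact hvk
  have hPN : c.P (th E ε L) = c.N (th E ε L) := by
    refine eq_of_trig _ _ (fun y => ?_) (fun y => ?_)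
    · obtain ⟨v, hv, hvE, h⟩ := hex y
      exact c.anti_orth hc hL hε hv hvE (bc_cos.comp (g := fun x : V => inner ℝ x y) (by fun_prop))
        (fun x => by rw [h x])
    · obtain ⟨v, hv, hvE, h⟩ := hex y
      exact c.anti_orth hc hL hε hv hvE (bc_sin.comp (g := fun x : V => inner ℝ x y) (by fun_prop))
        (fun x => by rw [h x])
  unfold CM.I II
  rw [hPN, sub_self]

theorem CM.anti_one [Nontrivial V] (c : CM V) (hc : c.Inv (-1)) {E : Submodule ℝ V} {L : Set E}
    (hL : Body L) {ε : ℝ} (hε : 0 < ε) (hE : Module.finrank ℝ Eᗮ = 1)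
    (ih : ∀ c' : CM E, c'.Inv (-1) → ∀ K, Body K → ∀ f, BC f → c'.I K f = 0)
    (hX : ∀ f, BC f → (∀ x, pe E x ∈ L → ‖x - pe E x‖ = ε → f x = 0) → c.I (th E ε L) f = 0)
    {f : V → ℝ} (hf : BC f) : c.I (th E ε L) f = 0 := by
  have : Nontrivial Eᗮ := Module.nontrivial_of_finrank_pos (R := ℝ) (by omega)
  obtain ⟨u, hu⟩ := exists_norm_eq Eᗮ (zero_le_one)
  have hu0 : u ≠ 0 := by
    intro h; rw [h] at hu; simp at hu
  have hu0' : (u:V) ≠ 0 := by simpa using hu0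
  have huu : inner ℝ (u:V) (u:V) = 1 := by
    rw [real_inner_self_eq_norm_sq]
    have : ‖(u:V)‖ = 1 := hu
    rw [this]; norm_num
  have hdec : ∀ x : V, x = pe E x + inner ℝ x (u:V) • (u:V) := by
    intro x
    obtain ⟨t, ht⟩ := (finrank_eq_one_iff_of_nonzero' u hu0).1 hE ⟨x - pe E x, sub_pe_mem x⟩
    have ht' : t • (u:V) = x - pe E x := congrArg Subtype.val ht
    have h1 : inner ℝ x (u:V) = t := by
      have e : x = pe E x + t • (u:V) := by rw [ht']; abel
      have h2 : inner ℝ (pe E x : V) (u:V) = 0 := (Submodule.mem_orthogonal E u).1 u.2 _ (pe E x).2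
      conv_lhs => rw [e]
      rw [inner_add_left, h2, zero_add, inner_smul_left, huu]; simp
    rw [h1, ht']; abel
  let χ : V → ℝ := fun x => max (-ε) (min ε (inner ℝ x (u:V)))
  have hχ : BC χ := by
    refine ⟨by fun_prop, ε, fun x => abs_le.2 ⟨le_max_left _ _, ?_⟩⟩
    exact max_le (by linarith) (min_le_left _ _)
  have hχE : ∀ e ∈ E, ∀ x, χ (x + e) = χ x := by
    intro e he x
    simp only [χ]
    rw [inner_add_left, (Submodule.mem_orthogonal E u).1 u.2 _ he, add_zero]
  let a : E → ℝ := fun e => 2⁻¹ * (f (e + ε • (u:V)) + f (e - ε • (u:V)))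
  let b : E → ℝ := fun e => (2 * ε)⁻¹ * (f (e + ε • (u:V)) - f (e - ε • (u:V)))
  have hf1 : BC fun e : E => f (e + ε • (u:V)) := hf.comp (by fun_prop)
  have hf2 : BC fun e : E => f (e - ε • (u:V)) := hf.comp (by fun_prop)
  have ha : BC a := (BC.const _).mul (hf1.add hf2)
  have hb : BC b := (BC.const _).mul (hf1.sub hf2)
  have i1 : c.I (th E ε L) (fun x => a (pe E x)) = 0 :=
    c.anti_orth hc hL hε hu0' u.2 (ha.comp (pe_cont E)) (fun x => by rw [pe_rf_orth u.2])
  have i2 : c.I (th E ε L) (fun x => χ x * b (pr E L x)) = 0 := by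
    rw [← c.I_push E hε.le hχ hχE hL hb]
    exact ih _ (c.push_inv E hε.le hχ hχE hc) L hL b hb
  have ba : BC fun x => a (pe E x) := ha.comp (pe_cont E)
  have bb : BC fun x => χ x * b (pr E L x) := hχ.mul (hb.comp (pr_cont hL))
  have i3 := hX _ (hf.sub (ba.add bb)) (fun x hx hxe => by
    have hp : pr E L x = pe E x := np_of_mem hL hx
    have hd := hdec x
    have hn : |inner ℝ x (u:V)| = ε := by
      have : x - pe E x = inner ℝ x (u:V) • (u:V) := sub_eq_iff_eq_add'.2 hd
      rw [this, norm_smul] at hxe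
      have h1 : ‖(u:V)‖ = 1 := hu
      rw [h1, mul_one] at hxe
      exact hxe
    rw [hp]
    simp only [a, b, χ]
    rcases (abs_eq hε.le).1 hn with h | h
    · rw [h, min_self, max_eq_right (by linarith)]
      rw [h] at hd
      rw [← hd]
      field_simp
      ring
    · rw [h, min_eq_right (by linarith), max_self]
      rw [h, neg_smul, ← sub_eq_add_neg] at hd
      rw [← hd]
      field_simp
      ring)
  unfold CM.I at i1 i2 i3 ⊢
  rw [II_sub _ _ hf (ba.add bb), II_add _ _ ba bb, i1, i2] at i3
  linarith

theorem A_zero (base : ∀ (V : Type) [NormedAddCommGroup V] [InnerProductSpace ℝ V]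
    [FiniteDimensional ℝ V] [MeasurableSpace V] [BorelSpace V], Module.finrank ℝ V = 2 →
    ∀ c : CM V, c.Inv (-1) → ∀ K, Body K → ∀ f, BC f → c.I K f = 0) (n : ℕ) :
    2 ≤ n → ∀ (V : Type) [NormedAddCommGroup V] [InnerProductSpace ℝ V]
    [FiniteDimensional ℝ V] [MeasurableSpace V] [BorelSpace V], Module.finrank ℝ V = n →
    ∀ c : CM V, c.Inv (-1) → ∀ K, Body K → ∀ f, BC f → c.I K f = 0 := by
  induction n with
  | zero => intro h; omega
  | succ n ih =>
    intro h2 V _ _ _ _ _ hn c hc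
    rcases eq_or_ne n 1 with h1 | h1
    · exact base V (by omega) c hc
    · have : Nontrivial V := Module.nontrivial_of_finrank_pos (R := ℝ) (by omega)
      refine c.zero_of_step (c.intZ_anti hc) ?_
      intro E L hL ε hε hX f hf
      have hsum := E.finrank_add_finrank_orthogonal
      by_cases hE : E = ⊤
      · exact top_step c hE hε hX hf
      · rcases le_or_gt 2 (Module.finrank ℝ Eᗮ) with h | h
        · exact c.anti_two hc hL hε h
        · have hlt : Module.finrank ℝ E < Module.finrank ℝ V := Submodule.finrank_lt hE
          exact c.anti_one hc hL hε (by omega) (fun c' hc' => ih (by omega) E (by omega) c' hc') hX hf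

end CMZ

namespace CMZ

set_option linter.unusedSectionVars false

variable {V : Type} [NormedAddCommGroup V] [InnerProductSpace ℝ V] [FiniteDimensional ℝ V]
  [MeasurableSpace V] [BorelSpace V]

theorem eq_of_balls (μ ν : Measure V) [IsFiniteMeasure μ] [IsFiniteMeasure ν]
    (h : ∀ x, ∃ r > 0, ∀ ρ, 0 < ρ → ρ < r → μ (closedBall x ρ) = ν (closedBall x ρ)) : μ = ν := by
  have h1 := Besicovitch.ae_tendsto_rnDeriv μ (μ + ν)
  have h2 := Besicovitch.ae_tendsto_rnDeriv ν (μ + ν)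
  have e : μ.rnDeriv (μ + ν) =ᵐ[μ + ν] ν.rnDeriv (μ + ν) := by
    filter_upwards [h1, h2] with x hx1 hx2
    refine tendsto_nhds_unique (hx1.congr' ?_) hx2
    obtain ⟨r, hr, hh⟩ := h x
    filter_upwards [Ioo_mem_nhdsGT hr] with ρ hρ
    rw [hh ρ hρ.1 hρ.2]
  have a1 : μ ≪ μ + ν := Measure.absolutelyContinuous_of_le (Measure.le_add_right le_rfl)
  have a2 : ν ≪ μ + ν := Measure.absolutelyContinuous_of_le (Measure.le_add_left le_rfl)
  rw [← Measure.withDensity_rnDeriv_eq μ (μ+ν) a1, withDensity_congr_ae e,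
    Measure.withDensity_rnDeriv_eq ν (μ+ν) a2]

theorem eq_of_radial (μ ν : Measure V) [IsFiniteMeasure μ] [IsFiniteMeasure ν]
    (h : ∀ x, ∃ r > 0, ∀ φ : ℝ → ℝ, BC φ → (∀ t, r ≤ t → φ t = 0) →
      II μ ν (fun y => φ ‖y - x‖) = 0) : μ = ν := by
  refine eq_of_balls μ ν fun x => ?_
  obtain ⟨r, hr, hh⟩ := h x
  refine ⟨r, hr, fun ρ h0 hρ => ?_⟩
  have hm : Measurable fun y : V => ‖y - x‖ := by fun_prop
  have key := restrict_eq_of_II (μ.map fun y => ‖y - x‖) (ν.map fun y => ‖y - x‖)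
    (isOpen_Iio (a := r)) (fun φ hφ hz => by
      unfold II
      rw [integral_map hm.aemeasurable hφ.1.aestronglyMeasurable,
        integral_map hm.aemeasurable hφ.1.aestronglyMeasurable]
      exact hh φ hφ fun t ht => hz t (by simpa using ht))
  have := congrArg (fun m : Measure ℝ => m (Set.Iic ρ)) key
  have hs : Set.Iic ρ ∩ Set.Iio r = Set.Iic ρ := Set.inter_eq_left.2 fun t ht => lt_of_le_of_lt ht hρ
  simp only [Measure.restrict_apply measurableSet_Iic, hs, Measure.map_apply hm measurableSet_Iic] at this
  have hb : closedBall x ρ = (fun y : V => ‖y - x‖) ⁻¹' Set.Iic ρ := by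
    ext y; simp [dist_eq_norm]
  rw [hb, this]

theorem CM.zero_of_sym [Nontrivial V] (c : CM V) (hc : c.Inv (-1)) {K : Set V} (hK : Body K)
    (h : ∀ x ∈ K, ∃ v ≠ 0, ∃ r > 0, ∀ y ∈ ball (0:V) r, y + x ∈ K → rf v y + x ∈ K) (f : V → ℝ) :
    c.I K f = 0 := by
  suffices c.P K = c.N K by unfold CM.I II; rw [this, sub_self]
  refine eq_of_radial _ _ fun x => ?_
  by_cases hx : x ∈ K
  · obtain ⟨v, hv, r, hr, hh⟩ := h x hx
    refine ⟨r, hr, fun φ hφ hz => ?_⟩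
    have bφ : BC fun y : V => φ ‖y‖ := hφ.comp continuous_norm
    have bφ' : BC fun y : V => φ ‖y - x‖ := hφ.comp (by fun_prop)
    have hT := hK.translate (-x)
    have e1 := c.trans K hK (-x) _ bφ
    simp only [← sub_eq_add_neg] at e1
    rw [← e1]
    simp only [sub_eq_add_neg]
    have e2 := hc v hv _ hT _ bφ
    simp only [norm_rf hv] at e2
    have e3 := c.loc _ _ (ball 0 r) hT (hT.rf v) isOpen_ball (by
      ext y
      simp only [Set.mem_inter_iff, mem_rf_image hv, mem_translate, sub_neg_eq_add]
      refine and_congr_left fun hy => ⟨hh y hy, fun h' => ?_⟩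
      have := hh (rf v y) (by rw [mem_ball_zero_iff] at hy ⊢; rwa [norm_rf hv]) h'
      rwa [rf_rf hv] at this) _ bφ (fun y hy => hz _ (by simpa using hy))
    unfold CM.I at e2
    linarith
  · obtain ⟨r, hr, hrK⟩ := Metric.isOpen_iff.1 hK.2.1.isClosed.isOpen_compl x hx
    refine ⟨r, hr, fun φ hφ hz => ?_⟩
    refine c.I_supp hK (f := fun y => φ ‖y - x‖) (hφ.comp (by fun_prop)) fun y hy => hz _ ?_
    by_contra hlt
    push Not at hlt
    exact hrK (by rwa [mem_ball, dist_eq_norm]) hy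

theorem scal {α β s : ℝ} (ha : α < 0) (hb : 0 ≤ β) (h1 : -1 < s) (h2 : s < 1)
    (h3 : s ≤ α + β * s) (h4 : α * s + β ≤ 1) (h5 : α^2 + β^2 + 2*α*β*s = 1) : False := by
  rcases lt_trichotomy s 0 with hs | hs | hs
  · have hb1 : β < 1 := by nlinarith
    have h6 : (α + β * s)^2 = 1 - β^2 * (1 - s^2) := by linarith
    have h7 : β^2 < 1 := by nlinarith
    have h8 : 0 < 1 - s^2 := by nlinarith
    have h9 : s^2 < (α + β * s)^2 := by rw [h6]; nlinarith
    have h10 : β * s ≤ 0 := mul_nonpos_of_nonneg_of_nonpos hb hs.le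
    nlinarith
  · subst hs; linarith
  · have h6 : β - 1 ≤ - α * s := by linarith
    have h7 : s * (β - 1) ≤ s * (-α * s) := mul_le_mul_of_nonneg_left h6 hs.le
    have h8 : s^2 < 1 := by nlinarith
    nlinarith

theorem cone_sym (hV : Module.finrank ℝ V = 2) {A : Set V} (hA : A.Finite) (hu : ∀ a ∈ A, ‖a‖ = 1) :
    ∃ v ≠ (0:V), ∀ y, (∀ a ∈ A, inner ℝ a y ≤ 0) → ∀ a ∈ A, inner ℝ a (rf v y) ≤ 0 := by
  have : Nontrivial V := Module.nontrivial_of_finrank_pos (R := ℝ) (by omega)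
  rcases A.eq_empty_or_nonempty with rfl | hne
  · obtain ⟨e, he⟩ := exists_ne (0 : V)
    exact ⟨e, he, by simp⟩
  obtain ⟨⟨a, b⟩, hab, hmin⟩ := Set.exists_min_image (A ×ˢ A) (fun p => inner ℝ p.1 p.2)
    (hA.prod hA) (hne.prod hne)
  obtain ⟨ha, hb⟩ : a ∈ A ∧ b ∈ A := hab
  have hmin' : ∀ x ∈ A, ∀ y ∈ A, inner ℝ a b ≤ inner ℝ x y := fun x hx y hy => hmin (x, y) ⟨hx, hy⟩
  have hself : ∀ x ∈ A, inner ℝ x x = 1 := fun x hx => by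
    rw [real_inner_self_eq_norm_sq, hu x hx]; norm_num
  have hle : ∀ x ∈ A, ∀ y ∈ A, inner ℝ x y ≤ 1 := fun x hx y hy => by
    have := real_inner_le_norm x y
    rwa [hu x hx, hu y hy, one_mul] at this
  have hge : -1 ≤ inner ℝ a b := by
    have := neg_le_of_abs_le (abs_real_inner_le_norm a b)
    rwa [hu a ha, hu b hb, one_mul] at this
  have ha0 : a ≠ 0 := fun h => by have := hu a ha; rw [h] at this; simp at this
  rcases (hle a ha b hb).eq_or_lt with h1 | h1
  · have hall : ∀ x ∈ A, x = a := fun x hx => by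
      rw [← inner_eq_one_iff_of_norm_eq_one (𝕜 := ℝ) (hu x hx) (hu a ha)]
      exact le_antisymm (hle x hx a ha) (h1 ▸ hmin' x hx a ha)
    have hk : (innerₛₗ ℝ a).ker ≠ ⊥ := LinearMap.ker_ne_bot_of_finrank_lt (by
      rw [Module.finrank_self]; omega)
    obtain ⟨v, hvk, hv⟩ := Submodule.exists_mem_ne_zero_of_ne_bot hk
    refine ⟨v, hv, fun y hy x hx => ?_⟩
    have e : inner ℝ v a = 0 := by rw [real_inner_comm]; exact hvk
    rw [hall x hx, ← inner_rf_left hv, rf_of_inner e]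
    exact hy a ha
  rcases hge.eq_or_lt with h2 | h2
  · have hba : b = -a := by
      rw [eq_comm, ← inner_eq_one_iff_of_norm_eq_one (𝕜 := ℝ) (by rw [norm_neg]; exact hu a ha) (hu b hb),
        inner_neg_left, ← h2, neg_neg]
    refine ⟨a, ha0, fun y hy => ?_⟩
    have e : inner ℝ a y = 0 := by
      have := hy b hb
      rw [hba, inner_neg_left] at this
      have := hy a ha
      linarith
    rw [rf_of_inner e]; exact hy
  set s := inner ℝ a b with hs
  have hne : a ≠ b := by
    intro h; rw [hs, ← h, hself a ha] at h1; linarith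
  have hsub : a - b ≠ 0 := sub_ne_zero.2 hne
  have hra : rf (a - b) a = b := rf_swap (by rw [hu a ha, hu b hb]) hne
  have hrb : rf (a - b) b = a := by have := rf_rf hsub a; rwa [hra] at this
  refine ⟨a - b, hsub, fun y hy x hx => ?_⟩
  have hli : LinearIndependent ℝ ![a, b] := by
    rw [LinearIndependent.pair_iff]
    intro p q hpq
    have e1 : p + q * s = 0 := by
      have := congrArg (fun z => inner ℝ a z) hpq
      simpa [inner_add_right, inner_smul_right, hu a ha, ← hs] using this
    have e2 : p * s + q = 0 := by
      have := congrArg (fun z => inner ℝ b z) hpq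
      simpa [inner_add_right, inner_smul_right, hu b hb, real_inner_comm a b, ← hs] using this
    have e3 : q * (1 - s^2) = 0 := by linear_combination e2 - s * e1
    have e4 : 1 - s^2 ≠ 0 := by nlinarith
    have e5 : q = 0 := by simpa [e4] using e3
    rw [e5] at e1
    exact ⟨by linarith, e5⟩
  have hspan := hli.span_eq_top_of_card_eq_finrank' (by simp [hV])
  have hxs : x ∈ Submodule.span ℝ (Set.range ![a, b]) := hspan ▸ Submodule.mem_top
  rw [Matrix.range_cons, Matrix.range_cons, Matrix.range_empty, Set.union_empty,
    Set.singleton_union, Submodule.mem_span_pair] at hxs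
  obtain ⟨α, β, hx'⟩ := hxs
  have i1 : inner ℝ x a = α + β * s := by
    rw [← hx', inner_add_left, inner_smul_left, inner_smul_left, hself a ha, real_inner_comm a b, ← hs]
    simp
  have i2 : inner ℝ x b = α * s + β := by
    rw [← hx', inner_add_left, inner_smul_left, inner_smul_left, hself b hb, ← hs]
    simp
  have i3 : α^2 + β^2 + 2*α*β*s = 1 := by
    have := hself x hx
    nth_rw 2 [← hx'] at this
    rw [inner_add_right, inner_smul_right, inner_smul_right, i1, i2] at this
    linarith
  have j1 := hmin' x hx a ha
  have j2 := hmin' x hx b hb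
  have k1 := hle x hx a ha
  have k2 := hle x hx b hb
  rw [i1] at j1 k1
  rw [i2] at j2 k2
  have ya := hy a ha
  have yb := hy b hb
  have yx := hy x hx
  have yx' := yx
  rw [← hx', inner_add_left, inner_smul_left, inner_smul_left] at yx'
  simp only [conj_trivial] at yx'
  have hexp : inner ℝ x (rf (a-b) y) = α * inner ℝ b y + β * inner ℝ a y := by
    rw [← inner_rf_left hsub, ← hx', rf_add, rf_smul, rf_smul, hra, hrb, inner_add_left,
      inner_smul_left, inner_smul_left]
    simp
  rw [hexp]
  rcases lt_or_ge α 0 with hα | hα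
  · rcases lt_or_ge β 0 with hβ | hβ
    · have m1 : 0 ≤ α * inner ℝ a y := mul_nonneg_of_nonpos_of_nonpos hα.le ya
      have m2 : 0 ≤ β * inner ℝ b y := mul_nonneg_of_nonpos_of_nonpos hβ.le yb
      have z1 : α * inner ℝ a y = 0 := by linarith
      have z2 : β * inner ℝ b y = 0 := by linarith
      have z1' : inner ℝ a y = 0 := by simpa [hα.ne] using z1
      have z2' : inner ℝ b y = 0 := by simpa [hβ.ne] using z2
      rw [z1', z2']; simp
    · exact (scal hα hβ h2 h1 j1 k2 i3).elim
  · rcases lt_or_ge β 0 with hβ | hβ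
    · exact (scal hβ hα h2 h1 (by linarith) (by linarith) (by linarith)).elim
    · have := mul_nonpos_of_nonneg_of_nonpos hα yb
      have := mul_nonpos_of_nonneg_of_nonpos hβ ya
      linarith

theorem poly_approx {K : Set V} (hK : Body K) {δ : ℝ} (hδ : 0 < δ) :
    ∃ S : Set (V × ℝ), S.Finite ∧ (∀ p ∈ S, ‖p.1‖ = 1) ∧
      Body {y : V | ∀ p ∈ S, inner ℝ p.1 y ≤ p.2} ∧ K ⊆ {y : V | ∀ p ∈ S, inner ℝ p.1 y ≤ p.2} ∧
      {y : V | ∀ p ∈ S, inner ℝ p.1 y ≤ p.2} ⊆ cthickening δ K := by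
  have cinf : Continuous fun z : V => infDist z K := continuous_infDist_pt K
  have hZc : IsCompact {z : V | infDist z K = δ} := by
    refine (body_cth hK hδ.le).2.1.of_isClosed_subset (isClosed_eq cinf continuous_const) ?_
    intro z hz
    rw [mem_cth hK hδ.le, ← infDist_np hK]
    exact le_of_eq hz
  let n : V → V := fun z => δ⁻¹ • (z - np K z)
  let U : V → Set V := fun z => {y | inner ℝ (n z) (np K z) < inner ℝ (n z) y}
  have hUo : ∀ z, IsOpen (U z) := fun z => isOpen_lt continuous_const (by fun_prop)
  have hzU : ∀ z ∈ {z : V | infDist z K = δ}, z ∈ U z := by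
    intro z hz
    have hz' : ‖z - np K z‖ = δ := by rw [← infDist_np hK]; exact hz
    change inner ℝ (n z) (np K z) < inner ℝ (n z) z
    rw [← sub_pos, ← inner_sub_right, inner_smul_left, real_inner_self_eq_norm_sq, hz']
    simp; positivity
  obtain ⟨t, htZ, htc⟩ := hZc.elim_nhds_subcover U (fun z hz => (hUo z).mem_nhds (hzU z hz))
  let S : Set (V × ℝ) := (fun z => (n z, inner ℝ (n z) (np K z))) '' (t : Set V)
  have hS : {y : V | ∀ p ∈ S, inner ℝ p.1 y ≤ p.2}
      = {y : V | ∀ z ∈ t, inner ℝ (n z) y ≤ inner ℝ (n z) (np K z)} := by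
    ext y
    constructor
    · intro h z hz
      exact h _ ⟨z, hz, rfl⟩
    · rintro h _ ⟨z, hz, rfl⟩
      exact h z hz
  have hconv : Convex ℝ {y : V | ∀ p ∈ S, inner ℝ p.1 y ≤ p.2} := by
    intro x hx y hy a b ha hb hab p hp
    rw [inner_add_right, inner_smul_right, inner_smul_right]
    have h1 := mul_le_mul_of_nonneg_left (hx p hp) ha
    have h2 := mul_le_mul_of_nonneg_left (hy p hp) hb
    have : a * p.2 + b * p.2 = p.2 := by rw [← add_mul, hab, one_mul]
    linarith
  have hcl : IsClosed {y : V | ∀ p ∈ S, inner ℝ p.1 y ≤ p.2} := by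
    have : {y : V | ∀ p ∈ S, inner ℝ p.1 y ≤ p.2} = ⋂ p ∈ S, {y : V | inner ℝ p.1 y ≤ p.2} := by
      ext; simp
    rw [this]
    exact isClosed_biInter fun p _ => isClosed_le (by fun_prop) continuous_const
  have hKP : K ⊆ {y : V | ∀ p ∈ S, inner ℝ p.1 y ≤ p.2} := by
    rw [hS]
    intro k hk z hz
    have := np_le hK z hk
    rw [← sub_nonpos, ← inner_sub_right, inner_smul_left]
    exact mul_nonpos_of_nonneg_of_nonpos (by simp; positivity) this
  have hPK : {y : V | ∀ p ∈ S, inner ℝ p.1 y ≤ p.2} ⊆ cthickening δ K := by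
    intro y hy
    by_contra hcon
    rw [mem_cth hK hδ.le, ← infDist_np hK, not_le] at hcon
    obtain ⟨k, hk⟩ := hK.1
    have hk0 : infDist k K = 0 := infDist_zero_of_mem hk
    have hc : ContinuousOn (fun s : ℝ => infDist (AffineMap.lineMap k y s) K) (Set.Icc 0 1) :=
      (cinf.comp (AffineMap.lineMap_continuous)).continuousOn
    have := intermediate_value_Icc (zero_le_one' ℝ) hc
    obtain ⟨s, hs, hsd⟩ := this (show δ ∈ _ by
      simp only [AffineMap.lineMap_apply_zero, AffineMap.lineMap_apply_one, hk0]
      exact ⟨hδ.le, hcon.le⟩)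
    have hw : AffineMap.lineMap k y s ∈ {y : V | ∀ p ∈ S, inner ℝ p.1 y ≤ p.2} :=
      hconv.segment_subset (hKP hk) hy (by
        rw [segment_eq_image_lineMap]; exact ⟨s, hs, rfl⟩)
    have hw2 := htc hsd
    simp only [Set.mem_iUnion] at hw2
    obtain ⟨z, hz, hzw⟩ := hw2
    rw [hS] at hw
    exact absurd (hw z hz) (not_le.2 hzw)
  refine ⟨S, t.finite_toSet.image _, ?_, ⟨hK.1.mono hKP,
    (body_cth hK hδ.le).2.1.of_isClosed_subset hcl hPK, hconv⟩, hKP, hPK⟩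
  rintro _ ⟨z, hz, rfl⟩
  have hz' : ‖z - np K z‖ = δ := by rw [← infDist_np hK]; exact htZ z hz
  simp only [n]
  rw [norm_smul, hz', norm_inv, Real.norm_of_nonneg hδ.le]
  field_simp

theorem base2 (V : Type) [NormedAddCommGroup V] [InnerProductSpace ℝ V]
    [FiniteDimensional ℝ V] [MeasurableSpace V] [BorelSpace V] (hV : Module.finrank ℝ V = 2)
    (c : CM V) (hc : c.Inv (-1)) : ∀ K, Body K → ∀ f, BC f → c.I K f = 0 := by
  intro K hK f hf
  have : Nontrivial V := Module.nontrivial_of_finrank_pos (R := ℝ) (by omega)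
  have hδ : ∀ i : ℕ, 0 < 1 / ((i:ℝ) + 1) := fun i => by positivity
  choose S hSf hSu hSb hKS hSK using fun i : ℕ => poly_approx hK (hδ i)
  have hz : ∀ i, c.I {y : V | ∀ p ∈ S i, inner ℝ p.1 y ≤ p.2} f = 0 := by
    intro i
    refine c.zero_of_sym hc (hSb i) (fun x hx => ?_) f
    obtain ⟨v, hv, hcone⟩ := cone_sym hV (A := Prod.fst '' {p ∈ S i | inner ℝ p.1 x = p.2})
      (((hSf i).subset (Set.sep_subset _ _)).image _) (by
        rintro _ ⟨p, hp, rfl⟩; exact hSu i p hp.1)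
    have hev : ∀ᶠ y in 𝓝 (0:V), ∀ p ∈ S i, inner ℝ p.1 x ≠ p.2 → inner ℝ p.1 (y + x) < p.2 := by
      rw [eventually_all_finite (hSf i)]
      intro p hp
      by_cases hpx : inner ℝ p.1 x = p.2
      · simp [hpx]
      · have : inner ℝ p.1 ((0:V) + x) < p.2 := by
          rw [zero_add]; exact lt_of_le_of_ne (hx p hp) hpx
        have hcc : Continuous fun y : V => inner ℝ p.1 (y + x) := by fun_prop
        filter_upwards [hcc.continuousAt.eventually_lt continuousAt_const this] with y hy _ using hy
    obtain ⟨r, hr, hball⟩ := Metric.eventually_nhds_iff_ball.1 hev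
    refine ⟨v, hv, r, hr, fun y hy hyx p hp => ?_⟩
    by_cases hpx : inner ℝ p.1 x = p.2
    · have := hcone y (by
        rintro _ ⟨q, hq, rfl⟩
        have := hyx q hq.1
        rw [inner_add_right, hq.2] at this
        linarith) p.1 ⟨p, ⟨hp, hpx⟩, rfl⟩
      rw [inner_add_right, hpx]; linarith
    · exact (hball (rf v y) (by rw [mem_ball_zero_iff] at hy ⊢; rwa [norm_rf hv]) p hp hpx).le
  have ht := c.cont _ K hSb hK (by
    refine squeeze_zero (fun _ => hausdorffDist_nonneg) (fun i => ?_)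
      (tendsto_one_div_add_atTop_nhds_zero_nat (𝕜 := ℝ))
    refine hausdorffDist_le_of_mem_dist (hδ i).le (fun x hx => ?_) (fun x hx => ⟨x, hKS i hx, by
      rw [dist_self]; exact (hδ i).le⟩)
    have := hSK i hx
    rw [mem_cth hK (hδ i).le, ← dist_eq_norm] at this
    exact ⟨_, np_mem hK x, this⟩) f hf
  have ht2 : Tendsto (fun _ : ℕ => (0:ℝ)) atTop (𝓝 (II (c.P K) (c.N K) f)) :=
    ht.congr fun i => hz i
  exact (tendsto_nhds_unique ht2 tendsto_const_nhds)

end CMZ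

namespace CMZ

set_option linter.unusedSectionVars false

variable {V : Type} [NormedAddCommGroup V] [InnerProductSpace ℝ V] [FiniteDimensional ℝ V]
  [MeasurableSpace V] [BorelSpace V]

theorem det_rfE {v : V} (hv : v ≠ 0) :
    LinearMap.det ((rfE hv).toLinearEquiv : V →ₗ[ℝ] V) = -1 := by
  have h : ((rfE hv).toLinearEquiv : V →ₗ[ℝ] V) = ((ℝ ∙ v)ᗮ).reflection.toLinearMap := by
    ext x
    change rf v x = (ℝ ∙ v)ᗮ.reflection x
    rw [Submodule.reflection_orthogonal_apply, Submodule.reflection_singleton_apply]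
    simp only [rf, real_inner_self_eq_norm_sq]
    rw [neg_sub, mul_div_assoc, ← smul_smul, ofNat_smul_eq_nsmul]
    simp
  rw [h]
  have := Submodule.det_reflection (𝕜 := ℝ) ((ℝ ∙ v)ᗮ)
  rw [this, Submodule.orthogonal_orthogonal, finrank_span_singleton hv, pow_one]

theorem II_eq_of {P N P' N' : Measure V} [IsFiniteMeasure P] [IsFiniteMeasure N]
    [IsFiniteMeasure P'] [IsFiniteMeasure N'] {U : Set V} (hU : MeasurableSet U)
    (h : ∀ β, MeasurableSet β → β ⊆ U → P.real β - N.real β = P'.real β - N'.real β)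
    {f : V → ℝ} (hf : BC f) (hz : ∀ x ∉ U, f x = 0) : II P N f = II P' N' f := by
  have e : (P + N').restrict U = (P' + N).restrict U := by
    ext β hβ
    rw [Measure.restrict_apply hβ, Measure.restrict_apply hβ]
    have := h (β ∩ U) (hβ.inter hU) Set.inter_subset_right
    rw [← measureReal_eq_measureReal_iff, measureReal_add_apply, measureReal_add_apply]
    linarith
  have e2 : ∫ x, f x ∂(P + N') = ∫ x, f x ∂(P' + N) := by
    rw [← setIntegral_eq_integral_of_forall_compl_eq_zero hz, e,
      setIntegral_eq_integral_of_forall_compl_eq_zero hz]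
  rw [integral_add_measure (hf.integrable _) (hf.integrable _),
    integral_add_measure (hf.integrable _) (hf.integrable _)] at e2
  unfold II
  linarith

theorem II_map {μ ν : Measure V} {g : V → V} (hg : Continuous g) {f : V → ℝ} (hf : BC f) :
    II (μ.map g) (ν.map g) f = II μ ν (fun x => f (g x)) := by
  unfold II
  rw [integral_map hg.measurable.aemeasurable hf.1.aestronglyMeasurable,
    integral_map hg.measurable.aemeasurable hf.1.aestronglyMeasurable]

theorem II_swap (μ ν : Measure V) (f : V → ℝ) : II ν μ f = - II μ ν f := by
  unfold II; ring

theorem II_addm {μ ν μ' ν' : Measure V} [IsFiniteMeasure μ] [IsFiniteMeasure ν]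
    [IsFiniteMeasure μ'] [IsFiniteMeasure ν'] {f : V → ℝ} (hf : BC f) :
    II (μ + μ') (ν + ν') f = II μ ν f + II μ' ν' f := by
  unfold II
  rw [integral_add_measure (hf.integrable _) (hf.integrable _),
    integral_add_measure (hf.integrable _) (hf.integrable _)]
  ring

noncomputable def CM.swap (c : CM V) : CM V where
  P := c.N
  N := c.P
  finP := c.finN
  finN := c.finP
  loc K L U hK hL hU h f hf hz := by
    rw [II_swap, c.loc K L U hK hL hU h f hf hz, ← II_swap]
  trans K hK x f hf := by
    rw [II_swap, c.trans K hK x f hf, ← II_swap]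
  cont Ki K hKi hK ht f hf := by
    have := (c.cont Ki K hKi hK ht f hf).neg
    simpa only [← II_swap] using this

noncomputable def CM.plus (c d : CM V) : CM V where
  P K := c.P K + d.P K
  N K := c.N K + d.N K
  finP K := inferInstance
  finN K := inferInstance
  loc K L U hK hL hU h f hf hz := by
    rw [II_addm hf, II_addm hf, c.loc K L U hK hL hU h f hf hz, d.loc K L U hK hL hU h f hf hz]
  trans K hK x f hf := by
    rw [II_addm hf, II_addm (hf.comp (by fun_prop)), c.trans K hK x f hf, d.trans K hK x f hf]
  cont Ki K hKi hK ht f hf := by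
    simp only [II_addm hf]
    exact (c.cont Ki K hKi hK ht f hf).add (d.cont Ki K hKi hK ht f hf)

noncomputable def CM.refl (c : CM V) {e : V} (he : e ≠ 0) : CM V where
  P K := (c.P (rf e '' K)).map (rf e)
  N K := (c.N (rf e '' K)).map (rf e)
  finP K := inferInstance
  finN K := inferInstance
  loc K L U hK hL hU h f hf hz := by
    rw [II_map (rf_cont e) hf, II_map (rf_cont e) hf]
    refine c.loc _ _ (rf e ⁻¹' U) (hK.rf e) (hL.rf e) (hU.preimage (rf_cont e)) ?_ _
      (hf.comp (rf_cont e)) (fun x hx => hz _ hx)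
    ext y
    have := Set.ext_iff.1 h (rf e y)
    simpa only [Set.mem_inter_iff, mem_rf_image he, Set.mem_preimage] using this
  trans K hK x f hf := by
    rw [II_map (rf_cont e) hf, II_map (rf_cont e) (hf.comp (by fun_prop))]
    have h : rf e '' ((fun y => y + x) '' K) = (fun y => y + rf e x) '' (rf e '' K) := by
      simp only [Set.image_image, rf_add]
    rw [h, c.trans _ (hK.rf e) _ _ (hf.comp (rf_cont e))]
    simp only [rf_add, rf_rf he]
  cont Ki K hKi hK ht f hf := by
    simp only [II_map (rf_cont e) hf]
    refine c.cont _ _ (fun i => (hKi i).rf e) (hK.rf e) ?_ _ (hf.comp (rf_cont e))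
    have hi : Isometry (rf e) := (rfE he).isometry
    simpa only [hausdorffDist_image hi] using ht

/-- invariance under products of two reflections -/
def CM.Rot (c : CM V) : Prop :=
  ∀ v w : V, v ≠ 0 → w ≠ 0 → ∀ K, Body K → ∀ f, BC f →
    c.I (rf v '' (rf w '' K)) f = c.I K (fun x => f (rf v (rf w x)))

theorem rf_image_image {e : V} (he : e ≠ 0) (K : Set V) : rf e '' (rf e '' K) = K := by
  simp only [Set.image_image, rf_rf he, Set.image_id']

theorem CM.zero_of_rot (hn : 2 ≤ Module.finrank ℝ V) (c : CM V) (hr : c.Rot)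
    (hg : ∀ K, Body K → c.I K (fun _ => 1) = 0) : ∀ K, Body K → ∀ f, BC f → c.I K f = 0 := by
  have : Nontrivial V := Module.nontrivial_of_finrank_pos (R := ℝ) (by omega)
  obtain ⟨e, he⟩ := exists_ne (0 : V)
  have h1 : ∀ v, v ≠ 0 → ∀ K, Body K → ∀ f, BC f →
      c.I (rf e '' (rf v '' K)) (fun x => f (rf e x)) = c.I K (fun x => f (rf v x)) := by
    intro v hv K hK f hf
    rw [hr e v he hv K hK _ (hf.comp (rf_cont e))]
    simp only [rf_rf he]
  have h2 : ∀ v, v ≠ 0 → ∀ K, Body K → ∀ f, BC f →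
      c.I (rf v '' K) f = c.I (rf e '' K) (fun x => f (rf v (rf e x))) := by
    intro v hv K hK f hf
    have := hr v e hv he (rf e '' K) (hK.rf e) f hf
    rwa [rf_image_image he] at this
  have ip : ∀ K, ∀ f, BC f → (c.plus (c.refl he)).I K f
      = c.I K f + c.I (rf e '' K) (fun x => f (rf e x)) := by
    intro K f hf
    exact (II_addm hf).trans (congrArg _ (II_map (rf_cont e) hf))
  have im : ∀ K, ∀ f, BC f → (c.plus (c.refl he).swap).I K f
      = c.I K f - c.I (rf e '' K) (fun x => f (rf e x)) := by
    intro K f hf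
    refine (II_addm hf).trans ?_
    rw [sub_eq_add_neg]
    exact congrArg _ ((II_swap _ _ _).trans (congrArg _ (II_map (rf_cont e) hf)))
  have hp : (c.plus (c.refl he)).Inv 1 := by
    intro v hv K hK f hf
    rw [ip _ _ hf, ip _ _ (hf.comp (rf_cont v)), h1 v hv K hK f hf, h2 v hv K hK f hf]
    ring
  have hm : (c.plus (c.refl he).swap).Inv (-1) := by
    intro v hv K hK f hf
    rw [im _ _ hf, im _ _ (hf.comp (rf_cont v)), h1 v hv K hK f hf, h2 v hv K hK f hf]
    ring
  have zp := O_zero _ V rfl _ hp (fun K hK => by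
    rw [ip _ _ (BC.const 1), hg K hK, hg _ (hK.rf e), add_zero])
  have zm := A_zero (fun V _ _ _ _ _ => base2 V) _ hn V rfl _ hm
  intro K hK f hf
  have a1 := zp K hK f hf
  have a2 := zm K hK f hf
  rw [ip _ _ hf] at a1
  rw [im _ _ hf] at a2
  linarith

noncomputable def SI (s : SignedMeasure V) (f : V → ℝ) : ℝ :=
  II s.toJordanDecomposition.posPart s.toJordanDecomposition.negPart f

theorem SI_eq_of {s t : SignedMeasure V} {U : Set V} (hU : MeasurableSet U)
    (h : ∀ β, MeasurableSet β → β ⊆ U → s β = t β)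
    {f : V → ℝ} (hf : BC f) (hz : ∀ x ∉ U, f x = 0) : SI s f = SI t f := by
  refine II_eq_of hU (fun β hβ hb => ?_) hf hz
  rw [← SignedMeasure.apply_eq_posPart_real_sub_negPart_real s hβ,
    ← SignedMeasure.apply_eq_posPart_real_sub_negPart_real t hβ, h β hβ hb]

theorem SI_map {s t : SignedMeasure V} {g : V → V} (hg : Continuous g)
    (h : ∀ β, MeasurableSet β → s β = t (g ⁻¹' β))
    {f : V → ℝ} (hf : BC f) : SI s f = SI t (fun x => f (g x)) := by
  unfold SI
  rw [← II_map hg hf]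
  refine II_eq_of MeasurableSet.univ (fun β hβ hb => ?_) hf (by simp)
  rw [← SignedMeasure.apply_eq_posPart_real_sub_negPart_real s hβ,
    map_measureReal_apply hg.measurable hβ, map_measureReal_apply hg.measurable hβ,
    ← SignedMeasure.apply_eq_posPart_real_sub_negPart_real t (hg.measurable hβ), h β hβ]

theorem signed_zero (hn : 2 ≤ Module.finrank ℝ V) (s : Set V → SignedMeasure V)
    (hloc : ∀ K L U : Set V, Body K → Body L → IsOpen U →
      K ∩ U = L ∩ U → ∀ β : Set V, MeasurableSet β → β ⊆ U → s K β = s L β)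
    (htr : ∀ K, Body K → ∀ x : V, ∀ β, MeasurableSet β →
      s ((fun y => y + x) '' K) ((fun y => y + x) '' β) = s K β)
    (hcont : ∀ (Ki : ℕ → Set V) (K : Set V), (∀ i, Body (Ki i)) → Body K →
      Tendsto (fun i => hausdorffDist (Ki i) K) atTop (𝓝 0) → ∀ f, BC f →
      Tendsto (fun i => SI (s (Ki i)) f) atTop (𝓝 (SI (s K) f)))
    (hrot : ∀ ρ : V ≃ₗᵢ[ℝ] V, 0 < LinearMap.det (ρ.toLinearEquiv : V →ₗ[ℝ] V) →
      ∀ K, Body K → ∀ β, MeasurableSet β → s (ρ '' K) (ρ '' β) = s K β)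
    (hg : ∀ K, Body K → s K Set.univ = 0) :
    ∀ K, Body K → ∀ β, MeasurableSet β → s K β = 0 := by
  let c : CM V :=
    { P := fun K => (s K).toJordanDecomposition.posPart
      N := fun K => (s K).toJordanDecomposition.negPart
      finP := fun K => inferInstance
      finN := fun K => inferInstance
      loc := fun K L U hK hL hU h f hf hz =>
        SI_eq_of hU.measurableSet (hloc K L U hK hL hU h) hf hz
      trans := fun K hK x f hf => by
        refine SI_map (g := fun y => y + x) (by fun_prop) (fun β hβ => ?_) hf
        have hm : Measurable fun y : V => y + x := by fun_prop
        rw [← htr K hK x _ (hm hβ), Set.image_preimage_eq β (add_right_surjective x)]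
      cont := hcont }
  have hr : c.Rot := by
    intro v w hv hw K hK f hf
    refine SI_map (g := fun y => rf v (rf w y)) ((rf_cont v).comp (rf_cont w)) (fun β hβ => ?_) hf
    have hm : Measurable fun y : V => rf v (rf w y) := ((rf_cont v).comp (rf_cont w)).measurable
    have hdet : 0 < LinearMap.det (((rfE hw).trans (rfE hv)).toLinearEquiv : V →ₗ[ℝ] V) := by
      have e : (((rfE hw).trans (rfE hv)).toLinearEquiv : V →ₗ[ℝ] V)
        = ((rfE hv).toLinearEquiv : V →ₗ[ℝ] V) ∘ₗ ((rfE hw).toLinearEquiv : V →ₗ[ℝ] V) := rfl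
      rw [e, LinearMap.det_comp, det_rfE, det_rfE]; norm_num
    have := hrot ((rfE hw).trans (rfE hv)) hdet K hK _ (hm hβ)
    have e1 : ((rfE hw).trans (rfE hv)) '' K = rf v '' (rf w '' K) := by
      rw [Set.image_image]; rfl
    have e2 : ((rfE hw).trans (rfE hv)) '' ((fun y => rf v (rf w y)) ⁻¹' β) = β :=
      Set.image_preimage_eq β ((rfE hw).trans (rfE hv)).surjective
    rw [e1, e2] at this
    exact this
  have hgl : ∀ K, Body K → c.I K (fun _ => 1) = 0 := by
    intro K hK
    have := hg K hK
    rw [SignedMeasure.apply_eq_posPart_real_sub_negPart_real _ MeasurableSet.univ] at this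
    simpa [CM.I, II, c] using this
  intro K hK β hβ
  have hPN := eq_of_II _ _ (c.zero_of_rot hn hr hgl K hK)
  rw [SignedMeasure.apply_eq_posPart_real_sub_negPart_real _ hβ]
  have e : (s K).toJordanDecomposition.posPart = (s K).toJordanDecomposition.negPart := hPN
  rw [e, sub_self]

theorem cmI_ofReal {n : ℕ} (μ : ComplexMeasure (Rn n)) (f : Rn n → ℝ) :
    cmIntegral μ (fun x => (f x : ℂ))
      = (SI (ComplexMeasure.re μ) f : ℂ) + Complex.I * (SI (ComplexMeasure.im μ) f : ℂ) := by
  unfold cmIntegral SI II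
  simp only [integral_complex_ofReal]
  push_cast
  ring

end CMZ

/-- An SO(n) invariant translation invariant curvature measure that globalizes to zero
is identically zero. -/
theorem curvatureMeasure_eq_zero_of_SOInvariant_glob_eq_zero (n : ℕ) (hn : 2 ≤ n)
    (Φ : CurvatureMeasure n)
    (hglob : ∀ K : Set (Rn n), IsConvexBody K → Φ.meas K Set.univ = 0)
    (hinv : Φ.SOInvariant) :
    ∀ K : Set (Rn n), IsConvexBody K → ∀ β : Set (Rn n), MeasurableSet β →
      Φ.meas K β = 0 := by
  intro K hK β hβ
  have hfin : 2 ≤ Module.finrank ℝ (Rn n) := by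
    rw [finrank_euclideanSpace_fin]; exact hn
  have hc : ∀ (Ki : ℕ → Set (Rn n)) (K : Set (Rn n)), (∀ i, CMZ.Body (Ki i)) → CMZ.Body K →
      Tendsto (fun i => hausdorffDist (Ki i) K) atTop (𝓝 0) → ∀ f : Rn n → ℝ, CMZ.BC f →
      Tendsto (fun i => cmIntegral (Φ.meas (Ki i)) (fun x => (f x : ℂ))) atTop
        (𝓝 (cmIntegral (Φ.meas K) (fun x => (f x : ℂ)))) := by
    intro Ki K hKi hK ht f hf
    obtain ⟨hfc, C, hC⟩ := hf
    exact Φ.continuity Ki K hKi hK ht (BoundedContinuousFunction.ofNormedAddCommGroup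
      (fun x => (f x : ℂ)) (by fun_prop) C (fun x => by
        rw [Complex.norm_real]; exact hC x))
  have hre := CMZ.signed_zero hfin (fun K => ComplexMeasure.re (Φ.meas K))
    (fun K L U hK hL hU h β hβ hb => congrArg Complex.re (Φ.locality K L U hK hL hU h β hβ hb))
    (fun K hK x β hβ => congrArg Complex.re (Φ.translation_invariant K hK x β hβ))
    (fun Ki K hKi hK ht f hf => by
      have := (Complex.continuous_re.tendsto _).comp (hc Ki K hKi hK ht f hf)
      simpa [Function.comp_def, CMZ.cmI_ofReal] using this)
    (fun ρ hρ K hK β hβ => congrArg Complex.re (hinv ρ hρ K hK β hβ))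
    (fun K hK => congrArg Complex.re (hglob K hK)) K hK β hβ
  have him := CMZ.signed_zero hfin (fun K => ComplexMeasure.im (Φ.meas K))
    (fun K L U hK hL hU h β hβ hb => congrArg Complex.im (Φ.locality K L U hK hL hU h β hβ hb))
    (fun K hK x β hβ => congrArg Complex.im (Φ.translation_invariant K hK x β hβ))
    (fun Ki K hKi hK ht f hf => by
      have := (Complex.continuous_im.tendsto _).comp (hc Ki K hKi hK ht f hf)
      simpa [Function.comp_def, CMZ.cmI_ofReal] using this)
    (fun ρ hρ K hK β hβ => congrArg Complex.im (hinv ρ hρ K hK β hβ))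
    (fun K hK => congrArg Complex.im (hglob K hK)) K hK β hβ
  exact Complex.ext hre him
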